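/- arXiv:2503.09525 — 3 statements merged into one kernel-verified Lean document; each statement's English description precedes it below -/
import Mathlib

section
/- Let d ≥ 1 and n ≥ 1 be natural numbers. Let f : ℝ^d → ℝ be a continuous function and suppose there exist n pairwise distinct affine functions f_1, …, f_n : ℝ^d → ℝ such that for every x ∈ ℝ^d there is some i ∈ {1,…,n} with f(x) = f_i(x). Then there exists a finite family 𝒫 of open convex subsets of ℝ^d with cardinality |𝒫| ≤ (d+1)·n^{d+1}, such that ℝ^d = ⋃_{P ∈ 𝒫} closure(P) and f is affine on each P ∈ 𝒫 (i.e., for each P there is an affine map agreeing with f on P). In particular, every CPA function with n distinct affine components admits a set of at most (d+1)·n^{d+1} open convex pieces. -/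
/-- An affine function `ℝ^d → ℝ`, i.e. a map of the form `x ↦ ⟨a, x⟩ + b`. -/
def IsAffineFn {d : ℕ} (g : (Fin d → ℝ) → ℝ) : Prop :=
  ∃ (a : Fin d → ℝ) (b : ℝ), ∀ x, g x = (∑ i, a i * x i) + b

/-- `f` agrees with some affine map on the set `P`. -/
def AffineOnSet {d : ℕ} (f : (Fin d → ℝ) → ℝ) (P : Set (Fin d → ℝ)) : Prop :=
  ∃ g : (Fin d → ℝ) → ℝ, IsAffineFn g ∧ ∀ x ∈ P, f x = g x

/-- `Ps` is an admissible (finite) set of pieces for `f`: all pieces are open,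
connected, `f` is affine on each of them, and their closures cover `ℝ^d`. -/
def IsPieceSet {d : ℕ} (f : (Fin d → ℝ) → ℝ) (Ps : Finset (Set (Fin d → ℝ))) : Prop :=
  (∀ P ∈ Ps, IsOpen P ∧ IsConnected P ∧ AffineOnSet f P) ∧
    (⋃ P ∈ Ps, closure P) = Set.univ

/-- A continuous piecewise affine (CPA) function. -/
def IsCPA {d : ℕ} (f : (Fin d → ℝ) → ℝ) : Prop :=
  Continuous f ∧ ∃ Ps : Finset (Set (Fin d → ℝ)), IsPieceSet f Ps

/-- `P` is a maximal piece of `f`: open, connected, `f` affine on `P`, and it cannot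
be enlarged by a nonempty set `U ⊆ ℝ^d \ P` keeping openness, connectedness and affineness. -/
def IsMaximalPiece {d : ℕ} (f : (Fin d → ℝ) → ℝ) (P : Set (Fin d → ℝ)) : Prop :=
  IsOpen P ∧ IsConnected P ∧ AffineOnSet f P ∧
    ¬ ∃ U : Set (Fin d → ℝ), U.Nonempty ∧ U ⊆ Pᶜ ∧ IsOpen (P ∪ U) ∧
      IsConnected (P ∪ U) ∧ AffineOnSet f (P ∪ U)

namespace IsAffineFn

variable {d : ℕ} {g h : (Fin d → ℝ) → ℝ}

theorem continuous (hg : IsAffineFn g) : Continuous g := by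
  obtain ⟨a, b, hab⟩ := hg
  rw [funext hab]
  fun_prop

theorem sub (hg : IsAffineFn g) (hh : IsAffineFn h) : IsAffineFn fun x => g x - h x := by
  obtain ⟨a, b, hab⟩ := hg
  obtain ⟨a', b', hab'⟩ := hh
  refine ⟨a - a', b - b', fun x => ?_⟩
  simp only [hab, hab', Pi.sub_apply, sub_mul, Finset.sum_sub_distrib]
  ring

theorem map_combo (hg : IsAffineFn g) {s t : ℝ} (hst : s + t = 1) (x y : Fin d → ℝ) :
    g (s • x + t • y) = s * g x + t * g y := by
  obtain ⟨a, b, hab⟩ := hg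
  simp only [hab, Pi.add_apply, Pi.smul_apply, smul_eq_mul, mul_add, Finset.sum_add_distrib,
    Finset.mul_sum, mul_left_comm]
  linear_combination (-b) * hst

theorem convex_setOf_lt (hg : IsAffineFn g) (hh : IsAffineFn h) :
    Convex ℝ {x | g x < h x} := by
  intro x hx y hy s t hs ht hst
  simp only [Set.mem_ofPred_eq] at hx hy ⊢
  rw [hg.map_combo hst, hh.map_combo hst]
  rcases hs.eq_or_lt with rfl | hs'
  · obtain rfl : t = 1 := by linarith
    linarith
  · have := mul_lt_mul_of_pos_left hx hs'
    have := mul_le_mul_of_nonneg_left hy.le ht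
    linarith

theorem dense_setOf_ne (hg : IsAffineFn g) (hh : IsAffineFn h) (hgh : g ≠ h) :
    Dense {x | g x ≠ h x} := by
  obtain ⟨y, hy⟩ := Function.ne_iff.1 hgh
  intro x
  by_cases hx : g x = h x
  · have hcont : Continuous fun t : ℝ => (1 - t) • x + t • y := by fun_prop
    have hmem := map_mem_closure hcont (dense_compl_singleton (0 : ℝ) 0)
      (t := {x | g x ≠ h x}) fun t ht => by
        simp only [Set.mem_ofPred_eq]
        rw [hg.map_combo (by ring), hh.map_combo (by ring), hx]
        simpa [hy] using ht
    simpa using hmem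
  · exact subset_closure hx

end IsAffineFn

/-- More than `d` affine functions on `ℝ^d` miss one of the sign patterns without zeros. -/
theorem exists_sign_pattern_not_realized {d : ℕ} {ι : Type*} (S : Finset ι) (hS : d < S.card)
    (g : ι → (Fin d → ℝ) → ℝ) (hg : ∀ i, IsAffineFn (g i)) :
    ∃ T ⊆ S, ∀ x, ¬ ((∀ j ∈ T, 0 < g j x) ∧ ∀ j ∈ S, j ∉ T → g j x < 0) := by
  classical
  choose a b hab using hg
  have hdep : ¬ LinearIndependent ℝ fun j : S => a j := fun hli => by
    have := hli.fintype_card_le_finrank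
    simp only [Fintype.card_coe, Module.finrank_fintype_fun_eq_card, Fintype.card_fin] at this
    omega
  obtain ⟨c, hc, j₀, hj₀⟩ := Fintype.not_linearIndependent_iff.1 hdep
  wlog hb : 0 ≤ ∑ j, c j * b j generalizing c
  · refine this (-c) (by simpa using hc) (by simpa using hj₀) ?_
    simp only [Pi.neg_apply, neg_mul, Finset.sum_neg_distrib]
    linarith
  have hconst : ∀ x, ∑ j, c j * g j x = ∑ j, c j * b j := fun x => by
    have hlin : ∑ j : S, c j * ∑ i, a j i * x i = 0 := by
      simp_rw [Finset.mul_sum]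
      rw [Finset.sum_comm]
      refine Finset.sum_eq_zero fun i _ => ?_
      have := congrFun hc i
      simp only [Finset.sum_apply, Pi.smul_apply, smul_eq_mul, Pi.zero_apply] at this
      simp_rw [← mul_assoc, ← Finset.sum_mul, this, zero_mul]
    simp_rw [hab, mul_add, Finset.sum_add_distrib, hlin, zero_add]
  refine ⟨(Finset.univ.filter fun j => c j < 0).map (Function.Embedding.subtype _), ?_, ?_⟩
  · intro j hj
    simp only [Finset.mem_map, Function.Embedding.coe_subtype] at hj
    obtain ⟨j', -, rfl⟩ := hj
    exact j'.2
  · rintro x ⟨hpos, hneg⟩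
    have hlt : ∀ j : S, c j ≠ 0 → c j * g j x < 0 := fun j hj => by
      rcases hj.lt_or_gt with hj | hj
      · exact mul_neg_of_neg_of_pos hj (hpos j (by simpa using hj))
      · exact mul_neg_of_pos_of_neg hj (hneg j j.2 (by simpa using hj.le))
    have hsum : ∑ j, c j * g j x < ∑ _j : S, (0 : ℝ) := by
      refine Finset.sum_lt_sum (fun j _ => ?_) ⟨j₀, Finset.mem_univ _, hlt j₀ hj₀⟩
      rcases eq_or_ne (c j) 0 with hj | hj
      · simp [hj]
      · exact (hlt j hj).le
    rw [hconst, Finset.sum_const_zero] at hsum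
    linarith

section Cells

variable {d n : ℕ}

/-- The cell of points at which `F i` lies strictly below the `F j` with `j ∈ S` and strictly above
the other ones. -/
def affineCell (F : Fin n → (Fin d → ℝ) → ℝ) (i : Fin n) (S : Finset (Fin n)) :
    Set (Fin d → ℝ) :=
  {x | (∀ j ∈ S, F i x < F j x) ∧ ∀ j, j ∉ S → j ≠ i → F j x < F i x}

open Classical in
/-- The index sets of the nonempty cells of `F i`. -/
noncomputable def cellIndices (F : Fin n → (Fin d → ℝ) → ℝ) (i : Fin n) :
    Finset (Finset (Fin n)) :=
  Finset.univ.filter fun S => (affineCell F i S).Nonempty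

variable {F : Fin n → (Fin d → ℝ) → ℝ}

theorem mem_cellIndices {i : Fin n} {S : Finset (Fin n)} :
    S ∈ cellIndices F i ↔ (affineCell F i S).Nonempty := by
  simp [cellIndices]

theorem affineCell_eq_iInter (i : Fin n) (S : Finset (Fin n)) :
    affineCell F i S = (⋂ j, ⋂ _ : j ∈ S, {x | F i x < F j x}) ∩
      ⋂ j, ⋂ _ : j ∉ S, ⋂ _ : j ≠ i, {x | F j x < F i x} := by
  ext x
  simp [affineCell]

theorem isOpen_affineCell (hF : ∀ i, IsAffineFn (F i)) (i : Fin n) (S : Finset (Fin n)) :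
    IsOpen (affineCell F i S) := by
  rw [affineCell_eq_iInter]
  exact (isOpen_iInter_of_finite fun j => isOpen_iInter_of_finite fun _ =>
    isOpen_lt (hF i).continuous (hF j).continuous).inter
    (isOpen_iInter_of_finite fun j => isOpen_iInter_of_finite fun _ =>
      isOpen_iInter_of_finite fun _ => isOpen_lt (hF j).continuous (hF i).continuous)

theorem convex_affineCell (hF : ∀ i, IsAffineFn (F i)) (i : Fin n) (S : Finset (Fin n)) :
    Convex ℝ (affineCell F i S) := by
  rw [affineCell_eq_iInter]
  exact (convex_iInter fun j => convex_iInter fun _ => (hF i).convex_setOf_lt (hF j)).inter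
    (convex_iInter fun j => convex_iInter fun _ => convex_iInter fun _ =>
      (hF j).convex_setOf_lt (hF i))

theorem card_le_of_shatters_cellIndices (hF : ∀ i, IsAffineFn (F i)) {i : Fin n}
    {S : Finset (Fin n)} (hS : (cellIndices F i).Shatters S) : S.card ≤ d := by
  have hreal : ∀ T ⊆ S, ∃ A x, S ∩ A = T ∧ x ∈ affineCell F i A := fun T hT => by
    obtain ⟨A, hA, hAT⟩ := hS hT
    obtain ⟨x, hx⟩ := mem_cellIndices.1 hA
    exact ⟨A, x, hAT, hx⟩
  have hi : i ∉ S := fun hi => by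
    obtain ⟨A, x, hAS, hx⟩ := hreal S subset_rfl
    exact (hx.1 i (Finset.inter_eq_left.1 hAS hi)).false
  by_contra! hcard
  obtain ⟨T, hTS, hT⟩ := exists_sign_pattern_not_realized S hcard (fun j x => F j x - F i x)
    fun j => (hF j).sub (hF i)
  obtain ⟨A, x, rfl, hx⟩ := hreal T hTS
  refine hT x ⟨fun j hj => sub_pos.2 (hx.1 j (Finset.mem_inter.1 hj).2),
    fun j hj hjA => sub_neg.2 (hx.2 j (fun h => hjA (Finset.mem_inter.2 ⟨hj, h⟩)) ?_)⟩
  rintro rfl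
  exact hi hj

theorem card_cellIndices_le (hF : ∀ i, IsAffineFn (F i)) (hn : 1 ≤ n) (i : Fin n) :
    (cellIndices F i).card ≤ (d + 1) * n ^ d := by
  have hvc : (cellIndices F i).vcDim ≤ d :=
    Finset.sup_le fun S hS => card_le_of_shatters_cellIndices hF (Finset.mem_shatterer.1 hS)
  calc (cellIndices F i).card
      ≤ (cellIndices F i).shatterer.card := Finset.card_le_card_shatterer _
    _ ≤ ∑ k ∈ Finset.Iic (cellIndices F i).vcDim, (Fintype.card (Fin n)).choose k :=
        Finset.card_shatterer_le_sum_vcDim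
    _ ≤ ∑ k ∈ Finset.Iic d, n.choose k := by
        rw [Fintype.card_fin]
        exact Finset.sum_le_sum_of_subset (Finset.Iic_subset_Iic.2 hvc)
    _ ≤ ∑ _k ∈ Finset.Iic d, n ^ d := Finset.sum_le_sum fun k hk =>
        (Nat.choose_le_pow n k).trans (Nat.pow_le_pow_right hn (Finset.mem_Iic.1 hk))
    _ = (d + 1) * n ^ d := by simp

theorem eqOn_affineCell {f : (Fin d → ℝ) → ℝ} (hf : Continuous f)
    (hF : ∀ i, IsAffineFn (F i)) (hcover : ∀ x, ∃ i, f x = F i x) {i : Fin n}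
    {S : Finset (Fin n)} {x : Fin d → ℝ} (hx : x ∈ affineCell F i S) (hfx : f x = F i x) :
    Set.EqOn f (F i) (affineCell F i S) := by
  intro y hy
  by_contra hne
  have hclosed : ∀ j, IsClosed {z | f z = F j z} := fun j => isClosed_eq hf (hF j).continuous
  obtain ⟨j, hj⟩ := hcover y
  have hji : j ≠ i := by rintro rfl; exact hne hj
  obtain ⟨z, hz, hzi, hzj⟩ := isPreconnected_closed_iff.1 (convex_affineCell hF i S).isPreconnected
    {z | f z = F i z} (⋃ k : {k // k ≠ i}, {z | f z = F k z}) (hclosed i)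
    (isClosed_iUnion_of_finite fun k => hclosed k)
    (fun z _ => by
      obtain ⟨k, hk⟩ := hcover z
      by_cases hki : k = i
      · exact Or.inl (hki ▸ hk)
      · exact Or.inr (Set.mem_iUnion.2 ⟨⟨k, hki⟩, hk⟩))
    ⟨x, hx, hfx⟩ ⟨y, hy, Set.mem_iUnion.2 ⟨⟨j, hji⟩, hj⟩⟩
  obtain ⟨⟨k, hki⟩, hk⟩ := Set.mem_iUnion.1 hzj
  have heq : F i z = F k z := Eq.trans (Eq.symm hzi) hk
  by_cases hkS : k ∈ S
  · exact (hz.1 k hkS).ne heq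
  · exact (hz.2 k hkS hki).ne' heq

theorem dense_setOf_injective (hF : ∀ i, IsAffineFn (F i)) (hdist : Function.Injective F) :
    Dense {x | ∀ i j, i ≠ j → F i x ≠ F j x} := by
  have hdense : Dense (⋂ p : {p : Fin n × Fin n // p.1 ≠ p.2}, {x | F p.1.1 x ≠ F p.1.2 x}) :=
    dense_iInter_of_isOpen
      (fun p => isOpen_ne_fun (hF p.1.1).continuous (hF p.1.2).continuous)
      fun p => (hF p.1.1).dense_setOf_ne (hF p.1.2) (hdist.ne p.2)
  refine hdense.mono fun x hx i j hij => ?_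
  exact Set.mem_iInter.1 hx ⟨(i, j), hij⟩

end Cells

/-- If a continuous `f : ℝ^d → ℝ` agrees everywhere with one of `n`
pairwise distinct affine functions, then there is a family of at most `(d+1)·n^(d+1)`
open convex pieces whose closures cover `ℝ^d` and on each of which `f` is affine. -/
theorem cpa_upper_bound {d n : ℕ} (hd : 1 ≤ d) (hn : 1 ≤ n)
    (f : (Fin d → ℝ) → ℝ) (hf : Continuous f)
    (F : Fin n → (Fin d → ℝ) → ℝ) (hF : ∀ i, IsAffineFn (F i))
    (hdist : Function.Injective F)
    (hcover : ∀ x, ∃ i, f x = F i x) :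
    ∃ Ps : Finset (Set (Fin d → ℝ)),
      Ps.card ≤ (d + 1) * n ^ (d + 1) ∧
      (∀ P ∈ Ps, IsOpen P ∧ Convex ℝ P ∧ AffineOnSet f P) ∧
      (⋃ P ∈ Ps, closure P) = Set.univ := by
  classical
  refine ⟨(Finset.univ.biUnion fun i => (cellIndices F i).image (affineCell F i)).filter
    (AffineOnSet f), ?_, ?_, ?_⟩
  · calc _ ≤ (Finset.univ.biUnion fun i => (cellIndices F i).image (affineCell F i)).card :=
          Finset.card_filter_le _ _
      _ ≤ (Finset.univ : Finset (Fin n)).card * ((d + 1) * n ^ d) :=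
          Finset.card_biUnion_le_card_mul _ _ _ fun i _ =>
            Finset.card_image_le.trans (card_cellIndices_le hF hn i)
      _ = (d + 1) * n ^ (d + 1) := by
          rw [Finset.card_univ, Fintype.card_fin]
          ring
  · intro P hP
    simp only [Finset.mem_filter, Finset.mem_biUnion, Finset.mem_univ, true_and,
      Finset.mem_image] at hP
    obtain ⟨⟨i, S, -, rfl⟩, haff⟩ := hP
    exact ⟨isOpen_affineCell hF i S, convex_affineCell hF i S, haff⟩
  · rw [← Finset.closure_biUnion]
    refine ((dense_setOf_injective hF hdist).mono fun x hx => ?_).closure_eq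
    obtain ⟨i, hi⟩ := hcover x
    have hmem : x ∈ affineCell F i (Finset.univ.filter fun j => F i x < F j x) := by
      refine ⟨fun j hj => (Finset.mem_filter.1 hj).2, fun j hj hji => ?_⟩
      have hle : F j x ≤ F i x := by simpa using hj
      exact lt_of_le_of_ne hle (hx j i hji)
    refine Set.mem_biUnion (Finset.mem_coe.2 (Finset.mem_filter.2
      ⟨Finset.mem_biUnion.2 ⟨i, Finset.mem_univ _, Finset.mem_image_of_mem _
        (mem_cellIndices.2 ⟨x, hmem⟩)⟩, F i, hF i, ?_⟩)) hmem
    exact eqOn_affineCell hf hF hcover hmem hi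
end

section
/- There exist real constants β > 0 and c > 0 such that for every natural number n ≥ 2 there exists a CPA function f : ℝ → ℝ that has at most n affine components (i.e., there exist n affine functions g_1, …, g_n : ℝ → ℝ with: for every x ∈ ℝ there is i with f(x) = g_i(x)) and has at least β · n^{2 − c/√(log₂ n)} pairwise distinct maximal pieces. -/
/-- An affine function `ℝ → ℝ`, i.e. a map of the form `x ↦ a * x + b`. -/
def IsAffineFn1 (g : ℝ → ℝ) : Prop :=
  ∃ a b : ℝ, ∀ x, g x = a * x + b

/-- `f` agrees with some affine map on the set `P`. -/
def AffineOnSet1 (f : ℝ → ℝ) (P : Set ℝ) : Prop :=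
  ∃ g : ℝ → ℝ, IsAffineFn1 g ∧ ∀ x ∈ P, f x = g x

/-- `Ps` is an admissible (finite) set of pieces for `f`. -/
def IsPieceSet1 (f : ℝ → ℝ) (Ps : Finset (Set ℝ)) : Prop :=
  (∀ P ∈ Ps, IsOpen P ∧ IsConnected P ∧ AffineOnSet1 f P) ∧
    (⋃ P ∈ Ps, closure P) = Set.univ

/-- A continuous piecewise affine (CPA) function on `ℝ`. -/
def IsCPA1 (f : ℝ → ℝ) : Prop :=
  Continuous f ∧ ∃ Ps : Finset (Set ℝ), IsPieceSet1 f Ps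

/-- `P` is a maximal piece of `f`. -/
def IsMaximalPiece1 (f : ℝ → ℝ) (P : Set ℝ) : Prop :=
  IsOpen P ∧ IsConnected P ∧ AffineOnSet1 f P ∧
    ¬ ∃ U : Set ℝ, U.Nonempty ∧ U ⊆ Pᶜ ∧ IsOpen (P ∪ U) ∧
      IsConnected (P ∪ U) ∧ AffineOnSet1 f (P ∪ U)

/-- The affine function with slope `L.1` and intercept `L.2`. -/
def lineEval (L : ℝ × ℝ) (x : ℝ) : ℝ := L.1 * x + L.2

/-- The points `p` and `q` can be joined by a segment of slope `s` followed by a segment of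
slope `-s`, both on lines of the family `𝓛`. -/
def TentLinked (𝓛 : Set (ℝ × ℝ)) (p q : ℝ × ℝ) : Prop :=
  ∃ s : ℝ, 0 < s ∧ |q.2 - p.2| < s * (q.1 - p.1) ∧
    (s, p.2 - s * p.1) ∈ 𝓛 ∧ (-s, q.2 + s * q.1) ∈ 𝓛

/-- The points `p` and `q` of `W` are consecutive in the order of first coordinates. -/
def Consecutive (W : Finset (ℝ × ℝ)) (p q : ℝ × ℝ) : Prop :=
  p ∈ W ∧ q ∈ W ∧ p.1 < q.1 ∧ ∀ w ∈ W, w.1 ≤ p.1 ∨ q.1 ≤ w.1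

/-- The tent over the `i`-th gap: it rises with slope `S i` and falls with slope `-S i`. -/
noncomputable def tent (X Y S : ℕ → ℝ) (i : ℕ) (x : ℝ) : ℝ :=
  min (Y i + S i * (x - X i)) (Y (i + 1) - S i * (x - X (i + 1)))

/-- The abscissa of the top of the `i`-th tent. -/
noncomputable def tip (X Y S : ℕ → ℝ) (i : ℕ) : ℝ :=
  (X i + X (i + 1)) / 2 + (Y (i + 1) - Y i) / (2 * S i)

/-- The concatenation of the tents `0, …, k`. -/
noncomputable def zigzag (X Y S : ℕ → ℝ) : ℕ → ℝ → ℝ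
  | 0 => tent X Y S 0
  | k + 1 => fun x => if x ≤ X (k + 1) then zigzag X Y S k x else tent X Y S (k + 1) x

section Zigzag

variable {X Y S : ℕ → ℝ}

lemma tent_of_le_tip {i : ℕ} (hS : 0 < S i) {x : ℝ} (hx : x ≤ tip X Y S i) :
    tent X Y S i x = Y i + S i * (x - X i) := by
  refine min_eq_left ?_
  have h := mul_le_mul_of_nonneg_left hx (by positivity : 0 ≤ 2 * S i)
  have h2 : 2 * S i * tip X Y S i = S i * (X i + X (i + 1)) + (Y (i + 1) - Y i) := by
    unfold tip; field_simp
  linarith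

lemma tent_of_tip_le {i : ℕ} (hS : 0 < S i) {x : ℝ} (hx : tip X Y S i ≤ x) :
    tent X Y S i x = Y (i + 1) - S i * (x - X (i + 1)) := by
  refine min_eq_right ?_
  have h := mul_le_mul_of_nonneg_left hx (by positivity : 0 ≤ 2 * S i)
  have h2 : 2 * S i * tip X Y S i = S i * (X i + X (i + 1)) + (Y (i + 1) - Y i) := by
    unfold tip; field_simp
  linarith

lemma lt_tip {i : ℕ} (hS : 0 < S i) (h : |Y (i + 1) - Y i| < S i * (X (i + 1) - X i)) :
    X i < tip X Y S i := by
  have h2 : 2 * S i * tip X Y S i = S i * (X i + X (i + 1)) + (Y (i + 1) - Y i) := by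
    unfold tip; field_simp
  have := (abs_lt.1 h).1
  refine lt_of_mul_lt_mul_left (a := 2 * S i) ?_ (by positivity)
  linarith

lemma tip_lt {i : ℕ} (hS : 0 < S i) (h : |Y (i + 1) - Y i| < S i * (X (i + 1) - X i)) :
    tip X Y S i < X (i + 1) := by
  have h2 : 2 * S i * tip X Y S i = S i * (X i + X (i + 1)) + (Y (i + 1) - Y i) := by
    unfold tip; field_simp
  have := (abs_lt.1 h).2
  refine lt_of_mul_lt_mul_left (a := 2 * S i) ?_ (by positivity)
  linarith

lemma tent_left {i : ℕ} (hS : 0 < S i) (h : |Y (i + 1) - Y i| < S i * (X (i + 1) - X i)) :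
    tent X Y S i (X i) = Y i := by
  rw [tent_of_le_tip hS (lt_tip hS h).le]; ring

lemma tent_right {i : ℕ} (hS : 0 < S i) (h : |Y (i + 1) - Y i| < S i * (X (i + 1) - X i)) :
    tent X Y S i (X (i + 1)) = Y (i + 1) := by
  rw [tent_of_tip_le hS (tip_lt hS h).le]; ring

variable {k : ℕ}

lemma zigzag_of_ge (hS : ∀ i ≤ k, 0 < S i)
    (hY : ∀ i ≤ k, |Y (i + 1) - Y i| < S i * (X (i + 1) - X i))
    {x : ℝ} (hx : X k ≤ x) : zigzag X Y S k x = tent X Y S k x := by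
  induction k generalizing x with
  | zero => rfl
  | succ k ih =>
    unfold zigzag
    split_ifs with h
    · obtain rfl : x = X (k + 1) := le_antisymm h hx
      have hk := hS k (by omega)
      have hk' := hY k (by omega)
      rw [ih (fun i hi => hS i (by omega)) (fun i hi => hY i (by omega))
        ((lt_tip hk hk').trans (tip_lt hk hk')).le, tent_right hk hk',
        tent_left (hS _ le_rfl) (hY _ le_rfl)]
    · rfl

lemma abscissa_mono (hS : ∀ i ≤ k, 0 < S i)
    (hY : ∀ i ≤ k, |Y (i + 1) - Y i| < S i * (X (i + 1) - X i))
    {i j : ℕ} (hij : i ≤ j) (hj : j ≤ k + 1) : X i ≤ X j := by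
  induction j, hij using Nat.le_induction with
  | base => exact le_rfl
  | succ j hij ih =>
    have hk := hS j (by omega)
    have hk' := hY j (by omega)
    exact (ih (by omega)).trans ((lt_tip hk hk').trans (tip_lt hk hk')).le

lemma zigzag_of_mem (hS : ∀ i ≤ k, 0 < S i)
    (hY : ∀ i ≤ k, |Y (i + 1) - Y i| < S i * (X (i + 1) - X i))
    {i : ℕ} (hi : i ≤ k) {x : ℝ} (h1 : X i ≤ x) (h2 : x ≤ X (i + 1)) :
    zigzag X Y S k x = tent X Y S i x := by
  induction k with
  | zero =>
    obtain rfl : i = 0 := by omega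
    rfl
  | succ k ih =>
    rcases hi.eq_or_lt with rfl | hi'
    · exact zigzag_of_ge hS hY h1
    · have hx : x ≤ X (k + 1) := h2.trans (abscissa_mono hS hY (by omega) (by omega))
      unfold zigzag
      rw [if_pos hx]
      exact ih (fun i hi => hS i (by omega)) (fun i hi => hY i (by omega)) (by omega)

lemma zigzag_of_le (hS : ∀ i ≤ k, 0 < S i)
    (hY : ∀ i ≤ k, |Y (i + 1) - Y i| < S i * (X (i + 1) - X i))
    {x : ℝ} (hx : x ≤ X 1) : zigzag X Y S k x = tent X Y S 0 x := by
  induction k with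
  | zero => rfl
  | succ k ih =>
    have hx' : x ≤ X (k + 1) := hx.trans (abscissa_mono hS hY (by omega) (by omega))
    unfold zigzag
    rw [if_pos hx']
    exact ih (fun i hi => hS i (by omega)) (fun i hi => hY i (by omega))

lemma tent_continuous (i : ℕ) : Continuous (tent X Y S i) := by
  unfold tent; fun_prop

lemma zigzag_continuous (hS : ∀ i ≤ k, 0 < S i)
    (hY : ∀ i ≤ k, |Y (i + 1) - Y i| < S i * (X (i + 1) - X i)) : Continuous (zigzag X Y S k) := by
  induction k with
  | zero => exact tent_continuous 0
  | succ k ih =>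
    have hk := hS k (by omega)
    have hk' := hY k (by omega)
    have hS' : ∀ i ≤ k, 0 < S i := fun i hi => hS i (by omega)
    have hY' : ∀ i ≤ k, |Y (i + 1) - Y i| < S i * (X (i + 1) - X i) :=
      fun i hi => hY i (by omega)
    refine Continuous.if_le (ih hS' hY') (tent_continuous _) continuous_id continuous_const ?_
    rintro x rfl
    rw [zigzag_of_ge hS' hY' ((lt_tip hk hk').trans (tip_lt hk hk')).le, tent_right hk hk',
      tent_left (hS _ le_rfl) (hY _ le_rfl)]

lemma exists_zigzag_eq_tent (x : ℝ) : ∃ i ≤ k, zigzag X Y S k x = tent X Y S i x := by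
  induction k with
  | zero => exact ⟨0, le_rfl, rfl⟩
  | succ k ih =>
    unfold zigzag
    split_ifs
    · obtain ⟨i, hi, h⟩ := ih
      exact ⟨i, by omega, h⟩
    · exact ⟨k + 1, le_rfl, rfl⟩

lemma exists_gap {x : ℝ} (h0 : X 0 ≤ x) (h1 : x ≤ X (k + 1)) :
    ∃ i ≤ k, X i ≤ x ∧ x ≤ X (i + 1) := by
  induction k with
  | zero => exact ⟨0, le_rfl, h0, h1⟩
  | succ k ih =>
    rcases le_total x (X (k + 1)) with h | h
    · obtain ⟨i, hi, h⟩ := ih h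
      exact ⟨i, by omega, h⟩
    · exact ⟨k + 1, le_rfl, h, h1⟩

lemma affineOnSet1_of_eq {f : ℝ → ℝ} {P : Set ℝ} (y s c : ℝ)
    (h : ∀ x ∈ P, f x = y + s * (x - c)) : AffineOnSet1 f P :=
  ⟨fun x => y + s * (x - c), ⟨s, y - s * c, fun x => by ring⟩, h⟩

lemma zigzag_rising (hS : ∀ i ≤ k, 0 < S i)
    (hY : ∀ i ≤ k, |Y (i + 1) - Y i| < S i * (X (i + 1) - X i))
    {i : ℕ} (hi : i ≤ k) {x : ℝ} (hx : x ∈ Set.Ioo (X i) (tip X Y S i)) :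
    zigzag X Y S k x = Y i + S i * (x - X i) := by
  rw [zigzag_of_mem hS hY hi hx.1.le (hx.2.le.trans (tip_lt (hS i hi) (hY i hi)).le),
    tent_of_le_tip (hS i hi) hx.2.le]

lemma zigzag_falling (hS : ∀ i ≤ k, 0 < S i)
    (hY : ∀ i ≤ k, |Y (i + 1) - Y i| < S i * (X (i + 1) - X i))
    {i : ℕ} (hi : i ≤ k) {x : ℝ}
    (hx : x ∈ Set.Ioo (tip X Y S i) (X (i + 1))) :
    zigzag X Y S k x = Y (i + 1) + -S i * (x - X (i + 1)) := by
  rw [zigzag_of_mem hS hY hi ((lt_tip (hS i hi) (hY i hi)).le.trans hx.1.le) hx.2.le,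
    tent_of_tip_le (hS i hi) hx.1.le]
  ring

lemma zigzag_isCPA1 (hS : ∀ i ≤ k, 0 < S i)
    (hY : ∀ i ≤ k, |Y (i + 1) - Y i| < S i * (X (i + 1) - X i)) : IsCPA1 (zigzag X Y S k) := by
  classical
  refine ⟨zigzag_continuous hS hY,
    {Set.Iio (X 0), Set.Ioi (X (k + 1))} ∪
      ((Finset.range (k + 1)).image (fun i => Set.Ioo (X i) (tip X Y S i)) ∪
        (Finset.range (k + 1)).image (fun i => Set.Ioo (tip X Y S i) (X (i + 1)))), ?_, ?_⟩
  · intro P hP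
    simp only [Finset.mem_union, Finset.mem_insert, Finset.mem_singleton, Finset.mem_image,
      Finset.mem_range] at hP
    rcases hP with (rfl | rfl) | ⟨i, hi, rfl⟩ | ⟨i, hi, rfl⟩
    · refine ⟨isOpen_Iio, isConnected_Iio, affineOnSet1_of_eq (Y 0) (S 0) (X 0) fun x hx => ?_⟩
      have h0 := hS 0 (by omega)
      have h0' := hY 0 (by omega)
      have hx' : x ≤ tip X Y S 0 := (lt_trans hx (lt_tip h0 h0')).le
      rw [zigzag_of_le hS hY (hx'.trans (tip_lt h0 h0').le), tent_of_le_tip h0 hx']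
    · have hk := hS k le_rfl
      have hk' := hY k le_rfl
      refine ⟨isOpen_Ioi, isConnected_Ioi,
        affineOnSet1_of_eq (Y (k + 1)) (-S k) (X (k + 1)) fun x hx => ?_⟩
      have hx' : tip X Y S k ≤ x := (lt_trans (tip_lt hk hk') hx).le
      rw [zigzag_of_ge hS hY ((lt_tip hk hk').le.trans hx'), tent_of_tip_le hk hx']
      ring
    · exact ⟨isOpen_Ioo, isConnected_Ioo (lt_tip (hS i (by omega)) (hY i (by omega))),
        affineOnSet1_of_eq _ _ _ fun x hx => zigzag_rising hS hY (by omega) hx⟩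
    · exact ⟨isOpen_Ioo, isConnected_Ioo (tip_lt (hS i (by omega)) (hY i (by omega))),
        affineOnSet1_of_eq _ _ _ fun x hx => zigzag_falling hS hY (by omega) hx⟩
  · refine Set.eq_univ_of_forall fun x => ?_
    simp only [Set.mem_iUnion, exists_prop]
    rcases le_total x (X 0) with h | h0
    · exact ⟨Set.Iio (X 0), by simp, by rw [closure_Iio]; exact h⟩
    rcases le_total (X (k + 1)) x with h | h1
    · exact ⟨Set.Ioi (X (k + 1)), by simp, by rw [closure_Ioi]; exact h⟩
    obtain ⟨i, hi, h2, h3⟩ := exists_gap h0 h1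
    have hl := lt_tip (hS i hi) (hY i hi)
    have hr := tip_lt (hS i hi) (hY i hi)
    rcases le_total x (tip X Y S i) with h | h
    · refine ⟨Set.Ioo (X i) (tip X Y S i), ?_, ?_⟩
      · simp only [Finset.mem_union, Finset.mem_image, Finset.mem_range]
        exact Or.inr (Or.inl ⟨i, by omega, rfl⟩)
      · rw [closure_Ioo hl.ne]; exact ⟨h2, h⟩
    · refine ⟨Set.Ioo (tip X Y S i) (X (i + 1)), ?_, ?_⟩
      · simp only [Finset.mem_union, Finset.mem_image, Finset.mem_range]
        exact Or.inr (Or.inr ⟨i, by omega, rfl⟩)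
      · rw [closure_Ioo hr.ne]; exact ⟨h, h3⟩

end Zigzag

/-- Two affine functions agreeing on a nondegenerate interval have the same slope. -/
lemma slope_eq_of_eqOn_Ioo {a b y s c t d : ℝ} (hab : a < b)
    (h : ∀ x ∈ Set.Ioo a b, y + s * (x - c) = t * x + d) : s = t := by
  have h1 := h ((2 * a + b) / 3) ⟨by linarith, by linarith⟩
  have h2 := h ((a + 2 * b) / 3) ⟨by linarith, by linarith⟩
  have h3 : (s - t) * (b - a) = 0 := by linear_combination 3 * (h2 - h1)
  rcases mul_eq_zero.1 h3 with h | h <;> linarith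

/-- An interval on which `f` rises, and next to which `f` falls on both sides, is a maximal
piece. -/
lemma isMaximalPiece1_Ioo {f : ℝ → ℝ} {a b a' b' s s₁ s₂ y y₁ y₂ c c₁ c₂ : ℝ}
    (hab : a < b) (ha : a' < a) (hb : b < b') (hs : 0 < s) (hs₁ : 0 < s₁) (hs₂ : 0 < s₂)
    (h : ∀ x ∈ Set.Ioo a b, f x = y + s * (x - c))
    (h₁ : ∀ x ∈ Set.Ioo a' a, f x = y₁ + -s₁ * (x - c₁))
    (h₂ : ∀ x ∈ Set.Ioo b b', f x = y₂ + -s₂ * (x - c₂)) :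
    IsMaximalPiece1 f (Set.Ioo a b) := by
  refine ⟨isOpen_Ioo, isConnected_Ioo hab, affineOnSet1_of_eq _ _ _ h, ?_⟩
  rintro ⟨U, ⟨u, hu⟩, hUc, hopen, hconn, g, ⟨t, d, hg⟩, hfg⟩
  have hst : s = t := slope_eq_of_eqOn_Ioo hab (y := y) (c := c) (d := d) fun x hx => by
    rw [← h x hx, hfg x (Or.inl hx), hg]
  have hord := hconn.isPreconnected.ordConnected
  have hmid : (a + b) / 2 ∈ Set.Ioo a b ∪ U := Or.inl ⟨by linarith, by linarith⟩
  have hu' := hUc hu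
  rcases le_or_gt u a with hua | hua
  · have haP : a ∈ Set.Ioo a b ∪ U := hord.out (Or.inr hu) hmid ⟨hua, by linarith⟩
    obtain ⟨l, hl, hlP⟩ := exists_Ioc_subset_of_mem_nhds (hopen.mem_nhds haP) ⟨a', ha⟩
    have : -s₁ = t := slope_eq_of_eqOn_Ioo (max_lt hl ha) (y := y₁) (c := c₁) (d := d)
      fun x hx => by
        rw [← h₁ x ⟨(le_max_right _ _).trans_lt hx.1, hx.2⟩,
          hfg x (hlP ⟨(le_max_left _ _).trans_lt hx.1, hx.2.le⟩), hg]
    linarith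
  · have hbu : b ≤ u := by
      by_contra! hlt
      exact hu' ⟨hua, hlt⟩
    have hbP : b ∈ Set.Ioo a b ∪ U := hord.out hmid (Or.inr hu) ⟨by linarith, hbu⟩
    obtain ⟨l, hl, hlP⟩ := exists_Ico_subset_of_mem_nhds (hopen.mem_nhds hbP) ⟨b', hb⟩
    have : -s₂ = t := slope_eq_of_eqOn_Ioo (lt_min hl hb) (y := y₂) (c := c₂) (d := d)
      fun x hx => by
        rw [← h₂ x ⟨hx.1, hx.2.trans_le (min_le_right _ _)⟩,
          hfg x (hlP ⟨hx.1.le, hx.2.trans_le (min_le_left _ _)⟩), hg]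
    linarith

lemma exists_maximal_pieces_zigzag {X Y S : ℕ → ℝ} {k : ℕ} (hS : ∀ i ≤ k, 0 < S i)
    (hY : ∀ i ≤ k, |Y (i + 1) - Y i| < S i * (X (i + 1) - X i)) :
    ∃ Ps : Finset (Set ℝ), (∀ P ∈ Ps, IsMaximalPiece1 (zigzag X Y S k) P) ∧ Ps.card = k := by
  classical
  refine ⟨(Finset.range k).image fun i => Set.Ioo (X (i + 1)) (tip X Y S (i + 1)), ?_, ?_⟩
  · simp only [Finset.mem_image, Finset.mem_range]
    rintro P ⟨i, hi, rfl⟩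
    have h1 := hS (i + 1) hi
    have h1' := hY (i + 1) hi
    have h0 := hS i hi.le
    have h0' := hY i hi.le
    exact isMaximalPiece1_Ioo (lt_tip h1 h1') (tip_lt h0 h0') (tip_lt h1 h1') h1 h0 h1
      (fun x hx => zigzag_rising hS hY hi hx) (fun x hx => zigzag_falling hS hY hi.le hx)
      (fun x hx => zigzag_falling hS hY hi hx)
  · rw [Finset.card_image_of_injOn, Finset.card_range]
    intro i hi j hj hij
    have hi' : i + 1 ≤ k := by simpa using hi
    have hj' : j + 1 ≤ k := by simpa using hj
    have key : ∀ i j : ℕ, i < j → j + 1 ≤ k → X (i + 1) < X (j + 1) := fun i j hij hj =>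
      ((lt_tip (hS (i + 1) (by omega)) (hY _ (by omega))).trans
        (tip_lt (hS (i + 1) (by omega)) (hY _ (by omega)))).trans_le
          (abscissa_mono hS hY (by omega) (by omega))
    have hX : X (i + 1) = X (j + 1) := by
      have := congrArg sInf hij
      simpa [csInf_Ioo (lt_tip (hS _ hi') (hY _ hi')),
        csInf_Ioo (lt_tip (hS _ hj') (hY _ hj'))] using this
    rcases lt_trichotomy i j with h | h | h
    · exact absurd hX (key i j h hj').ne
    · exact h
    · exact absurd hX (key j i h hi').ne'

/-- The points of a finite set with distinct first coordinates, listed in increasing order. -/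
lemma exists_increasing_enumeration (W : Finset (ℝ × ℝ))
    (hinj : Set.InjOn Prod.fst (W : Set (ℝ × ℝ))) :
    ∃ p : ℕ → ℝ × ℝ, ∀ i, i + 1 < W.card → Consecutive W (p i) (p (i + 1)) := by
  classical
  have hcard : (W.image Prod.fst).card = W.card := Finset.card_image_of_injOn hinj
  let e := (W.image Prod.fst).orderIsoOfFin hcard
  have he : ∀ i : Fin W.card, ∃ w ∈ W, w.1 = (e i : ℝ) := fun i => by
    exact Finset.mem_image.1 (e i).2
  choose q hqW hq using he
  refine ⟨fun i => if h : i < W.card then q ⟨i, h⟩ else 0, fun i hi => ?_⟩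
  have hi' : i < W.card := by omega
  simp only [hi, hi', dif_pos]
  refine ⟨hqW _, hqW _, ?_, fun w hw => ?_⟩
  · rw [hq, hq]
    exact e.strictMono (by simp)
  · obtain ⟨j, hj⟩ := e.surjective ⟨w.1, Finset.mem_image_of_mem _ hw⟩
    have hj' : w.1 = (e j : ℝ) := by rw [hj]
    rw [hq, hq, hj']
    rcases le_or_gt (j : ℕ) i with h | h
    · exact Or.inl (e.monotone (by simpa [Fin.le_def] using h))
    · exact Or.inr (e.monotone (by simpa [Fin.le_def] using h))

/-- A finite point set whose consecutive points are linked by tents on a family of lines `𝓛`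
yields a CPA function with components in `𝓛` and almost as many maximal pieces as points. -/
lemma exists_cpa_of_tentLinked (W 𝓛 : Finset (ℝ × ℝ))
    (hinj : Set.InjOn Prod.fst (W : Set (ℝ × ℝ))) (hW : 2 ≤ W.card)
    (hlink : ∀ p q, Consecutive W p q → TentLinked (𝓛 : Set (ℝ × ℝ)) p q) :
    ∃ f : ℝ → ℝ, IsCPA1 f ∧ (∀ x, ∃ L ∈ 𝓛, f x = lineEval L x) ∧
      ∃ Ps : Finset (Set ℝ), (∀ P ∈ Ps, IsMaximalPiece1 f P) ∧ Ps.card = W.card - 2 := by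
  obtain ⟨p, hp⟩ := exists_increasing_enumeration W hinj
  have hs : ∀ i, ∃ s : ℝ, i + 1 < W.card → 0 < s ∧
      |(p (i + 1)).2 - (p i).2| < s * ((p (i + 1)).1 - (p i).1) ∧
      (s, (p i).2 - s * (p i).1) ∈ 𝓛 ∧ (-s, (p (i + 1)).2 + s * (p (i + 1)).1) ∈ 𝓛 := by
    intro i
    by_cases hi : i + 1 < W.card
    · obtain ⟨s, h⟩ := hlink _ _ (hp i hi)
      exact ⟨s, fun _ => by simpa using h⟩
    · exact ⟨0, fun h => absurd h hi⟩
  choose S hS using hs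
  have hpos : ∀ i ≤ W.card - 2, 0 < S i := fun i hi => (hS i (by omega)).1
  have hY : ∀ i ≤ W.card - 2, |(p (i + 1)).2 - (p i).2| < S i * ((p (i + 1)).1 - (p i).1) :=
    fun i hi => (hS i (by omega)).2.1
  refine ⟨zigzag (fun i => (p i).1) (fun i => (p i).2) S (W.card - 2),
    zigzag_isCPA1 (X := fun i => (p i).1) (Y := fun i => (p i).2) hpos hY, fun x => ?_,
    exists_maximal_pieces_zigzag (X := fun i => (p i).1) (Y := fun i => (p i).2) hpos hY⟩
  obtain ⟨i, hi, h⟩ := exists_zigzag_eq_tent (X := fun i => (p i).1) (Y := fun i => (p i).2)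
    (S := S) (k := W.card - 2) x
  obtain ⟨-, -, h1, h2⟩ := hS i (by omega)
  rw [h]
  rcases min_choice ((p i).2 + S i * (x - (p i).1))
    ((p (i + 1)).2 - S i * (x - (p (i + 1)).1)) with hmin | hmin
  · exact ⟨_, h1, by unfold tent lineEval; rw [hmin]; ring⟩
  · exact ⟨_, h2, by unfold tent lineEval; rw [hmin]; ring⟩

/-- Solutions of Pell's equation of every order of magnitude. -/
lemma exists_pell_solution (m : ℕ) (hm : 1 ≤ m) :
    ∃ A B : ℕ, A ^ 2 = 2 * B ^ 2 + 1 ∧ m ≤ B ∧ B ≤ 7 * m := by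
  induction m, hm using Nat.le_induction with
  | base => exact ⟨3, 2, by norm_num⟩
  | succ m hm ih =>
    obtain ⟨A, B, h, h1, h2⟩ := ih
    rcases h1.eq_or_lt with rfl | h1
    · refine ⟨3 * A + 4 * m, 2 * A + 3 * m, by nlinarith, by nlinarith, ?_⟩
      have : A ≤ 2 * m := by
        by_contra! hA
        nlinarith
      omega
    · exact ⟨A, B, h, h1, by omega⟩

/-- A number `a + b √2` of the box is not too small, and a cone around the first axis of large
slope contains the image of `a + b √2` under the Minkowski embedding. -/
lemma minkowski_bounds {m : ℕ} (hm : 1 ≤ m) {a b : ℤ} (ha : |a| ≤ m) (hb : |b| ≤ m)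
    (hx : 0 < (a : ℝ) + b * √2) {Q : ℝ} (hQ : 8 * (m : ℝ) ^ 2 ≤ Q) :
    1 ≤ 3 * m * ((a : ℝ) + b * √2) ∧ 1 / 2 ≤ Q * (a + b * √2) - |(a : ℝ) - b * √2| := by
  have h2 : √2 ^ 2 = 2 := Real.sq_sqrt (by norm_num)
  have h2' : √2 ≤ 1.42 := by
    rw [Real.sqrt_le_left (by norm_num)]; norm_num
  have h0 : 0 ≤ √2 := Real.sqrt_nonneg 2
  have hm' : (1 : ℝ) ≤ m := by exact_mod_cast hm
  have ha' : |(a : ℝ)| ≤ m := by exact_mod_cast ha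
  have hb' : |(b : ℝ)| ≤ m := by exact_mod_cast hb
  have hy : |(a : ℝ) - b * √2| ≤ 2.42 * m := by
    calc |(a : ℝ) - b * √2| ≤ |(a : ℝ)| + |(b : ℝ) * √2| := abs_sub _ _
      _ = |(a : ℝ)| + |(b : ℝ)| * √2 := by rw [abs_mul, abs_of_nonneg h0]
      _ ≤ m + m * 1.42 := by gcongr
      _ = 2.42 * m := by ring
  have hne : a ^ 2 - 2 * b ^ 2 ≠ 0 := by
    intro h
    have h' : (a : ℝ) ^ 2 = 2 * (b : ℝ) ^ 2 := by
      have : ((a ^ 2 - 2 * b ^ 2 : ℤ) : ℝ) = 0 := by rw [h]; simp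
      push_cast at this
      linarith
    have hy0 : (a : ℝ) - b * √2 = 0 := by
      have : ((a : ℝ) + b * √2) * (a - b * √2) = 0 := by
        linear_combination h' - (b : ℝ) ^ 2 * h2
      exact (mul_eq_zero.1 this).resolve_left hx.ne'
    rcases eq_or_ne b 0 with rfl | hb0
    · simp at hy0
      simp [hy0] at hx
    · refine irrational_sqrt_two ⟨(a : ℚ) / b, ?_⟩
      have : (b : ℝ) ≠ 0 := by exact_mod_cast hb0
      push_cast
      field_simp
      linarith
  have hnorm : 1 ≤ ((a : ℝ) + b * √2) * |(a : ℝ) - b * √2| := by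
    have h1 : (1 : ℝ) ≤ |(a : ℝ) ^ 2 - 2 * (b : ℝ) ^ 2| := by
      exact_mod_cast Int.one_le_abs hne
    have : (a : ℝ) ^ 2 - 2 * (b : ℝ) ^ 2 = ((a : ℝ) + b * √2) * (a - b * √2) := by
      linear_combination (b : ℝ) ^ 2 * h2
    rwa [this, abs_mul, abs_of_pos hx] at h1
  have hy0 : 0 ≤ |(a : ℝ) - b * √2| := abs_nonneg _
  generalize (a : ℝ) + b * √2 = x at *
  generalize |(a : ℝ) - b * √2| = y at *
  have hy3 : y ≤ 3 * m := by linarith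
  have h3 : 1 ≤ 3 * m * x := by nlinarith
  refine ⟨h3, ?_⟩
  by_contra! hlt
  have hypos : 0 < y := by nlinarith
  have e1 : 8 * (m : ℝ) ^ 2 ≤ Q * (x * y) := by nlinarith
  have e2 : (Q * x - y) * y ≤ 1 / 2 * y := by gcongr
  nlinarith

/-- The point `w` translated by the `lam`-multiple of the Minkowski image of `z.1 + z.2 √2`. -/
noncomputable def latticeTranslate (lam : ℝ) (z : ℕ × ℕ) (w : ℝ × ℝ) : ℝ × ℝ :=
  (lam * (z.1 + z.2 * √2) + w.1, lam * (z.1 - z.2 * √2) + w.2)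

/-- The indices of the translates. -/
def box (m : ℕ) : Finset (ℕ × ℕ) := Finset.range m ×ˢ Finset.range m

open Classical in
/-- The union of the translates of `W` over the box of size `m`. -/
noncomputable def spread (lam : ℝ) (m : ℕ) (W : Finset (ℝ × ℝ)) : Finset (ℝ × ℝ) :=
  (box m ×ˢ W).image fun u => latticeTranslate lam u.1 u.2

open Classical in
/-- A family of lines containing all translates over the box of size `m` of the lines of `𝓛`,
if these have slopes `± (A + B √2) ^ 2`. -/
noncomputable def spreadLines (lam : ℝ) (A B m : ℕ) (𝓛 : Finset (ℝ × ℝ)) : Finset (ℝ × ℝ) :=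
  (𝓛 ×ˢ Finset.range (4 * B * m)).image fun u =>
    (u.1.1, u.1.2 + lam * (A + B * √2) * u.2 * if 0 < u.1.1 then -(2 * √2) else 2)

lemma mem_box {m : ℕ} {z : ℕ × ℕ} : z ∈ box m ↔ z.1 < m ∧ z.2 < m := by
  simp [box]

lemma card_spreadLines_le (lam : ℝ) (A B m : ℕ) (𝓛 : Finset (ℝ × ℝ)) :
    (spreadLines lam A B m 𝓛).card ≤ 𝓛.card * (4 * B * m) := by
  classical
  exact Finset.card_image_le.trans (by simp)

lemma le_two_mul_of_pell {A B : ℕ} (h : A ^ 2 = 2 * B ^ 2 + 1) (hB : 1 ≤ B) : A ≤ 2 * B := by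
  by_contra! hA
  nlinarith

lemma translate_mem_spreadLines {lam s b : ℝ} {A B m : ℕ} {𝓛 : Finset (ℝ × ℝ)}
    (hAB : A ^ 2 = 2 * B ^ 2 + 1) (hB : 1 ≤ B) (hmem : (s, b) ∈ 𝓛)
    (hs : s = ((A : ℝ) + B * √2) ^ 2 ∨ s = -((A : ℝ) + B * √2) ^ 2) {z : ℕ × ℕ}
    (hz : z ∈ box m) :
    (s, b + lam * ((z.1 - z.2 * √2) - s * (z.1 + z.2 * √2))) ∈ spreadLines lam A B m 𝓛 := by
  classical
  have h2 : √2 ^ 2 = 2 := Real.sq_sqrt (by norm_num)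
  have hA := le_two_mul_of_pell hAB hB
  have hAB' : (A : ℝ) ^ 2 = 2 * (B : ℝ) ^ 2 + 1 := by exact_mod_cast hAB
  have hRpos : 0 < (A : ℝ) + B * √2 := by positivity
  rw [mem_box] at hz
  have hinv : ((A : ℝ) - B * √2) * (A + B * √2) = 1 := by
    linear_combination hAB' - (B : ℝ) ^ 2 * h2
  unfold spreadLines
  rw [Finset.mem_image]
  rcases hs with rfl | rfl
  · refine ⟨⟨(_, b), z.1 * B + z.2 * A⟩, Finset.mem_product.2 ⟨hmem, ?_⟩, ?_⟩
    · rw [Finset.mem_range]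
      nlinarith
    · simp only [pow_pos hRpos 2, if_true]
      refine Prod.ext rfl ?_
      push_cast
      linear_combination lam * ((z.1 : ℝ) - z.2 * √2) * hinv
  · refine ⟨⟨(_, b), z.1 * A + 2 * z.2 * B⟩, Finset.mem_product.2 ⟨hmem, ?_⟩, ?_⟩
    · rw [Finset.mem_range]
      nlinarith
    · have : ¬ 0 < -((A : ℝ) + B * √2) ^ 2 := by
        have := pow_pos hRpos 2
        linarith
      simp only [this, if_false]
      refine Prod.ext rfl ?_
      push_cast
      linear_combination lam * ((z.1 : ℝ) - z.2 * √2) * hinv - 2 * lam * (A + B * √2) * z.2 * B * h2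

lemma TentLinked.translate {lam : ℝ} {A B m : ℕ} {𝓛 : Finset (ℝ × ℝ)}
    (hAB : A ^ 2 = 2 * B ^ 2 + 1) (hB : 1 ≤ B)
    (hs : ∀ L ∈ 𝓛, L.1 = ((A : ℝ) + B * √2) ^ 2 ∨ L.1 = -((A : ℝ) + B * √2) ^ 2)
    {z : ℕ × ℕ} (hz : z ∈ box m) {p q : ℝ × ℝ} (h : TentLinked (𝓛 : Set (ℝ × ℝ)) p q) :
    TentLinked (spreadLines lam A B m 𝓛 : Set (ℝ × ℝ)) (latticeTranslate lam z p)
      (latticeTranslate lam z q) := by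
  obtain ⟨s, hs0, hlt, h1, h2⟩ := h
  have h1' := translate_mem_spreadLines (lam := lam) hAB hB h1 (hs _ h1) hz
  have h2' := translate_mem_spreadLines (lam := lam) hAB hB h2 (hs _ h2) hz
  refine ⟨s, hs0, ?_, ?_, ?_⟩
  · simpa [latticeTranslate] using hlt
  · convert Finset.mem_coe.2 h1' using 2
    simp only [latticeTranslate]; ring
  · convert Finset.mem_coe.2 h2' using 2
    simp only [latticeTranslate]; ring

open Classical in
/-- The two tent lines joining neighbouring translates of a set with leftmost point `p` and
rightmost point `q`. -/
noncomputable def bridgeLines (lam Q : ℝ) (m : ℕ) (p q : ℝ × ℝ) : Finset (ℝ × ℝ) :=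
  (box m).image (fun z => (Q, (latticeTranslate lam z q).2 - Q * (latticeTranslate lam z q).1)) ∪
    (box m).image (fun z => (-Q, (latticeTranslate lam z p).2 + Q * (latticeTranslate lam z p).1))

lemma card_bridgeLines_le (lam Q : ℝ) (m : ℕ) (p q : ℝ × ℝ) :
    (bridgeLines lam Q m p q).card ≤ 2 * m ^ 2 := by
  classical
  have hbox : (box m).card = m ^ 2 := by simp [box, sq]
  refine (Finset.card_union_le _ _).trans ?_
  have h1 := Finset.card_image_le (s := box m)
    (f := fun z => (Q, (latticeTranslate lam z q).2 - Q * (latticeTranslate lam z q).1))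
  have h2 := Finset.card_image_le (s := box m)
    (f := fun z => (-Q, (latticeTranslate lam z p).2 + Q * (latticeTranslate lam z p).1))
  omega

lemma abs_sub_le_of_mem_range {m a b : ℕ} (ha : a < m) (hb : b < m) :
    |(a : ℤ) - b| ≤ m := by
  rw [abs_le]; omega

/-- Translates of a bounded set are separated, and joined by steep tents. -/
lemma translate_gap {m : ℕ} (hm : 1 ≤ m) {z z' : ℕ × ℕ} (hz : z ∈ box m) (hz' : z' ∈ box m)
    (hlt : (z.1 : ℝ) + z.2 * √2 < z'.1 + z'.2 * √2) {Q D lam : ℝ} (hQ : 8 * (m : ℝ) ^ 2 ≤ Q)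
    (hD : 0 < D) (hlam1 : 6 * m * D < lam) (hlam2 : 4 * D * (Q + 1) < lam) {w w' : ℝ × ℝ}
    (hw : |w.1| ≤ D ∧ |w.2| ≤ D) (hw' : |w'.1| ≤ D ∧ |w'.2| ≤ D) :
    (latticeTranslate lam z w).1 < (latticeTranslate lam z' w').1 ∧
      |(latticeTranslate lam z' w').2 - (latticeTranslate lam z w).2| <
        Q * ((latticeTranslate lam z' w').1 - (latticeTranslate lam z w).1) := by
  rw [mem_box] at hz hz'
  have hm' : (1 : ℝ) ≤ m := by exact_mod_cast hm
  have hlam : 0 < lam := lt_trans (by positivity) hlam1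
  have hQ0 : 0 ≤ Q := le_trans (by positivity) hQ
  obtain ⟨h1, h2⟩ := minkowski_bounds hm (abs_sub_le_of_mem_range hz'.1 hz.1)
    (abs_sub_le_of_mem_range hz'.2 hz.2) (by push_cast; linarith) hQ
  push_cast at h1 h2
  have ew := abs_le.1 hw.1
  have ew' := abs_le.1 hw'.1
  have fw := abs_le.1 hw.2
  have fw' := abs_le.1 hw'.2
  simp only [latticeTranslate]
  set x : ℝ := (z'.1 - z.1 : ℝ) + (z'.2 - z.2) * √2 with hxdef
  set y : ℝ := (z'.1 - z.1 : ℝ) - (z'.2 - z.2) * √2 with hydef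
  have hx : lam * (z'.1 + z'.2 * √2) + w'.1 - (lam * (z.1 + z.2 * √2) + w.1) =
      lam * x + (w'.1 - w.1) := by rw [hxdef]; ring
  have hy : lam * (z'.1 - z'.2 * √2) + w'.2 - (lam * (z.1 - z.2 * √2) + w.2) =
      lam * y + (w'.2 - w.2) := by rw [hydef]; ring
  constructor
  · rw [← sub_pos, hx]
    have : 2 * D < lam * x := by
      have e1 : 6 * m * D * x < lam * x := by
        gcongr
        by_contra! hx0
        nlinarith
      have e2 : 2 * D * 1 ≤ 2 * D * (3 * m * x) := by gcongr
      linarith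
    linarith
  · rw [hx, hy]
    have e1 : |lam * y + (w'.2 - w.2)| ≤ lam * |y| + 2 * D := by
      refine (abs_add_le _ _).trans ?_
      rw [abs_mul, abs_of_pos hlam]
      have : |w'.2 - w.2| ≤ 2 * D := by rw [abs_le]; constructor <;> linarith
      linarith
    have e2 : lam * (1 / 2) ≤ lam * (Q * x - |y|) := by gcongr
    have e3 : Q * (-(2 * D)) ≤ Q * (w'.1 - w.1) := by gcongr; linarith
    refine e1.trans_lt ?_
    linarith

lemma lattice_injective {a b c d : ℕ} (h : (a : ℝ) + b * √2 = c + d * √2) : a = c ∧ b = d := by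
  have hbd : b = d := by
    by_contra hne
    refine irrational_sqrt_two ⟨((a : ℚ) - c) / (d - b), ?_⟩
    have : (d : ℝ) - b ≠ 0 := by
      rw [sub_ne_zero]; exact_mod_cast fun h : d = b => hne h.symm
    push_cast
    field_simp
    linarith
  subst hbd
  exact ⟨by exact_mod_cast add_right_cancel h, rfl⟩

/-- The consecutive points of `spread lam m W` lie in one translate of `W`, or they are the last
point of a translate and the first point of another one. -/
lemma spread_step {W : Finset (ℝ × ℝ)} (hinj : Set.InjOn Prod.fst (W : Set (ℝ × ℝ)))
    (hW : W.Nonempty) {m : ℕ} (hm : 1 ≤ m) {Q : ℝ} (hQ : 8 * (m : ℝ) ^ 2 ≤ Q) :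
    ∃ lam : ℝ, ∃ p q : ℝ × ℝ,
      Set.InjOn Prod.fst (spread lam m W : Set (ℝ × ℝ)) ∧
      (spread lam m W).card = m ^ 2 * W.card ∧
      ∀ u v, Consecutive (spread lam m W) u v →
        (∃ z ∈ box m, ∃ w w', Consecutive W w w' ∧ u = latticeTranslate lam z w ∧
          v = latticeTranslate lam z w') ∨
        TentLinked (bridgeLines lam Q m p q : Set (ℝ × ℝ)) u v := by
  classical
  obtain ⟨p, hp, hpmin⟩ := W.exists_min_image Prod.fst hW
  obtain ⟨q, hq, hqmax⟩ := W.exists_max_image Prod.fst hW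
  have hm' : (1 : ℝ) ≤ m := by exact_mod_cast hm
  have hQ0 : 0 < Q := lt_of_lt_of_le (by positivity) hQ
  obtain ⟨D, hD, hDW⟩ : ∃ D : ℝ, 0 < D ∧ ∀ w ∈ W, |w.1| ≤ D ∧ |w.2| ≤ D := by
    have hnn : ∀ w ∈ W, 0 ≤ |w.1| + |w.2| := fun w _ => by positivity
    refine ⟨1 + ∑ w ∈ W, (|w.1| + |w.2|), by linarith [Finset.sum_nonneg hnn], fun w hw => ?_⟩
    have := Finset.single_le_sum hnn hw
    have h1 := abs_nonneg w.1
    have h2 := abs_nonneg w.2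
    constructor <;> linarith
  set lam : ℝ := 1 + 6 * m * D + 4 * D * (Q + 1) with hlamdef
  have hlam1 : 6 * m * D < lam := by
    have : 0 < 4 * D * (Q + 1) := by positivity
    linarith
  have hlam2 : 4 * D * (Q + 1) < lam := by
    have : 0 < 6 * m * D := by positivity
    linarith
  have gap := fun {z z' : ℕ × ℕ} (hz : z ∈ box m) (hz' : z' ∈ box m)
    (hlt : (z.1 : ℝ) + z.2 * √2 < z'.1 + z'.2 * √2) {w w' : ℝ × ℝ} (hw : w ∈ W)
    (hw' : w' ∈ W) =>
      translate_gap hm hz hz' hlt hQ hD hlam1 hlam2 (hDW w hw) (hDW w' hw')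
  have key : ∀ z ∈ box m, ∀ z' ∈ box m, ∀ w ∈ W, ∀ w' ∈ W,
      (latticeTranslate lam z w).1 = (latticeTranslate lam z' w').1 → z = z' ∧ w = w' := by
    intro z hz z' hz' w hw w' hw' h
    have hzz : z = z' := by
      rcases lt_trichotomy ((z.1 : ℝ) + z.2 * √2) (z'.1 + z'.2 * √2) with h' | h' | h'
      · exact absurd h (gap hz hz' h' hw hw').1.ne
      · exact Prod.ext (lattice_injective h').1 (lattice_injective h').2
      · exact absurd h (gap hz' hz h' hw' hw).1.ne'
    subst hzz
    exact ⟨rfl, hinj hw hw' (by simpa [latticeTranslate] using h)⟩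
  have hmem : ∀ u, u ∈ spread lam m W ↔ ∃ z ∈ box m, ∃ w ∈ W, latticeTranslate lam z w = u := by
    intro u
    simp only [spread, Finset.mem_image, Finset.mem_product, Prod.exists]
    constructor
    · rintro ⟨a, b, c, d, ⟨h1, h2⟩, h3⟩
      exact ⟨a, b, h1, c, d, h2, h3⟩
    · rintro ⟨a, b, h1, c, d, h2, h3⟩
      exact ⟨a, b, c, d, ⟨h1, h2⟩, h3⟩
  refine ⟨lam, p, q, ?_, ?_, ?_⟩
  · intro u hu v hv huv
    obtain ⟨z, hz, w, hw, rfl⟩ := (hmem u).1 hu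
    obtain ⟨z', hz', w', hw', rfl⟩ := (hmem v).1 hv
    obtain ⟨rfl, rfl⟩ := key z hz z' hz' w hw w' hw' huv
    rfl
  · unfold spread
    rw [Finset.card_image_of_injOn, Finset.card_product]
    · simp [box, sq]
    · rintro ⟨z, w⟩ hu ⟨z', w'⟩ hv huv
      have hu' := Finset.mem_product.1 (Finset.mem_coe.1 hu)
      have hv' := Finset.mem_product.1 (Finset.mem_coe.1 hv)
      obtain ⟨rfl, rfl⟩ := key z hu'.1 z' hv'.1 w hu'.2 w' hv'.2 (congrArg Prod.fst huv)
      rfl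
  · rintro u v ⟨hu, hv, huv, hcons⟩
    obtain ⟨z, hz, w, hw, rfl⟩ := (hmem u).1 hu
    obtain ⟨z', hz', w', hw', rfl⟩ := (hmem v).1 hv
    rcases lt_trichotomy ((z.1 : ℝ) + z.2 * √2) (z'.1 + z'.2 * √2) with h' | h' | h'
    · right
      obtain rfl : w = q := by
        refine hinj hw hq (le_antisymm (hqmax w hw) ?_)
        rcases hcons _ ((hmem _).2 ⟨z, hz, q, hq, rfl⟩) with h | h
        · simpa [latticeTranslate] using h
        · exact absurd h (gap hz hz' h' hq hw').1.not_ge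
      obtain rfl : w' = p := by
        refine hinj hw' hp (le_antisymm ?_ (hpmin w' hw'))
        rcases hcons _ ((hmem _).2 ⟨z', hz', p, hp, rfl⟩) with h | h
        · exact absurd h (gap hz hz' h' hw hp).1.not_ge
        · simpa [latticeTranslate] using h
      refine ⟨Q, hQ0, (gap hz hz' h' hw hw').2, ?_, ?_⟩
      · exact Finset.mem_coe.2 (Finset.mem_union_left _ (Finset.mem_image.2 ⟨z, hz, rfl⟩))
      · exact Finset.mem_coe.2 (Finset.mem_union_right _ (Finset.mem_image.2 ⟨z', hz', rfl⟩))
    · left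
      obtain rfl : z = z' := Prod.ext (lattice_injective h').1 (lattice_injective h').2
      refine ⟨z, hz, w, w', ⟨hw, hw', by simpa [latticeTranslate] using huv, fun x hx => ?_⟩,
        rfl, rfl⟩
      simpa [latticeTranslate] using hcons _ ((hmem _).2 ⟨z, hz, x, hx, rfl⟩)
    · exact absurd huv (gap hz' hz h' hw' hw).1.not_gt

/-- The multi-scale construction: after `k` scales, with box sizes `m l`, there are
`∏ m l ^ 2` points whose consecutive pairs are linked by tents on one of the families `C l`. -/
lemma exists_multiscale (m A B : ℕ → ℕ) (hm : ∀ l, 1 ≤ m l)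
    (hAB : ∀ l, A l ^ 2 = 2 * B l ^ 2 + 1) (hmB : ∀ l, m l ≤ B l) (hB : ∀ l, B l ≤ 7 * m l)
    (k : ℕ) :
    ∃ (W : Finset (ℝ × ℝ)) (C : ℕ → Finset (ℝ × ℝ)),
      Set.InjOn Prod.fst (W : Set (ℝ × ℝ)) ∧ W.card = ∏ l ∈ Finset.range k, m l ^ 2 ∧
      (∀ l < k, (C l).card ≤ 2 * m l ^ 2 * ∏ j ∈ Finset.Ico (l + 1) k, 28 * m l * m j) ∧
      (∀ l < k, ∀ L ∈ C l, L.1 = ((A l : ℝ) + B l * √2) ^ 2 ∨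
        L.1 = -((A l : ℝ) + B l * √2) ^ 2) ∧
      ∀ p q, Consecutive W p q → ∃ l < k, TentLinked (C l : Set (ℝ × ℝ)) p q := by
  classical
  induction k with
  | zero =>
    refine ⟨{0}, fun _ => ∅, by simp, by simp, by simp, by simp, ?_⟩
    rintro p q ⟨hp, hq, h, -⟩
    rw [Finset.mem_singleton] at hp hq
    simp [hp, hq] at h
  | succ k ih =>
    obtain ⟨W, C, hinj, hcard, hC, hslope, hlink⟩ := ih
    have hW : W.Nonempty := by
      rw [← Finset.card_pos, hcard]
      exact Finset.prod_pos fun l _ => pow_pos (hm l) 2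
    have hQ : 8 * (m k : ℝ) ^ 2 ≤ ((A k : ℝ) + B k * √2) ^ 2 := by
      have h2 : √2 ^ 2 = 2 := Real.sq_sqrt (by norm_num)
      have h1 : (A k : ℝ) ^ 2 = 2 * (B k : ℝ) ^ 2 + 1 := by exact_mod_cast hAB k
      have h3 : (m k : ℝ) ≤ B k := by exact_mod_cast hmB k
      have h4 : (B k : ℝ) * √2 ≤ A k := abs_le_of_sq_le_sq' (by nlinarith) (by positivity) |>.2
      have h5 : (0 : ℝ) ≤ B k * √2 := by positivity
      have h6 : (m k : ℝ) ^ 2 ≤ (B k : ℝ) ^ 2 := by gcongr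
      nlinarith
    obtain ⟨lam, p, q, hinj', hcard', hstep⟩ := spread_step hinj hW (hm k) hQ
    refine ⟨spread lam (m k) W, fun l => if l = k then
      bridgeLines lam (((A k : ℝ) + B k * √2) ^ 2) (m k) p q
      else spreadLines lam (A l) (B l) (m k) (C l), hinj', ?_, ?_, ?_, ?_⟩
    · rw [hcard', hcard, Finset.prod_range_succ, mul_comm]
    · intro l hl
      dsimp only
      split_ifs with h
      · subst h
        simpa using card_bridgeLines_le _ _ _ _ _
      · have hlk : l < k := by omega
        rw [Finset.prod_Ico_succ_top (by omega)]
        calc _ ≤ (C l).card * (4 * B l * m k) := card_spreadLines_le _ _ _ _ _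
          _ ≤ (2 * m l ^ 2 * ∏ j ∈ Finset.Ico (l + 1) k, 28 * m l * m j) *
              (4 * (7 * m l) * m k) := by
            gcongr
            · exact hC l hlk
            · exact hB l
          _ = _ := by ring
    · intro l hl L hL
      dsimp only at hL
      split_ifs at hL with h
      · subst h
        simp only [bridgeLines, Finset.mem_union, Finset.mem_image] at hL
        rcases hL with ⟨z, -, rfl⟩ | ⟨z, -, rfl⟩
        · exact Or.inl rfl
        · exact Or.inr rfl
      · simp only [spreadLines, Finset.mem_image, Finset.mem_product] at hL
        obtain ⟨u, ⟨hu, -⟩, rfl⟩ := hL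
        exact hslope l (by omega) u.1 hu
    · intro u v huv
      rcases hstep u v huv with ⟨z, hz, w, w', hww, rfl, rfl⟩ | h
      · obtain ⟨l, hl, h⟩ := hlink w w' hww
        refine ⟨l, by omega, ?_⟩
        dsimp only
        rw [if_neg hl.ne]
        exact h.translate (hAB l) ((hm l).trans (hmB l)) (hslope l hl) hz
      · refine ⟨k, by omega, ?_⟩
        simpa using h

lemma TentLinked.mono {𝓛 𝓛' : Set (ℝ × ℝ)} (h : 𝓛 ⊆ 𝓛') {p q : ℝ × ℝ}
    (hpq : TentLinked 𝓛 p q) : TentLinked 𝓛' p q := by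
  obtain ⟨s, h0, h1, h2, h3⟩ := hpq
  exact ⟨s, h0, h1, h h2, h h3⟩

/-- The sum of the binary logarithms of the first `l` box sizes, up to an additive constant. -/
def cumulativeScale (K l : ℕ) : ℕ := K ^ 2 / (K - l + 1)

lemma cumulativeScale_mono (K : ℕ) : Monotone (cumulativeScale K) := fun _ _ h =>
  Nat.div_le_div_left (by omega) (by omega)

lemma prod_two_pow_sub {g : ℕ → ℕ} (hg : Monotone g) {a b : ℕ} (hab : a ≤ b) :
    ∏ j ∈ Finset.Ico a b, 2 ^ (g (j + 1) - g j) = 2 ^ (g b - g a) := by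
  induction b, hab using Nat.le_induction with
  | base => simp
  | succ b hab ih =>
    rw [Finset.prod_Ico_succ_top hab, ih, ← pow_add]
    have h1 := hg hab
    have h2 := hg (Nat.le_succ b)
    congr 1
    simp only [Nat.succ_eq_add_one] at h2
    omega

/-- The number of lines at a single scale. -/
lemma lines_le_two_pow {K l : ℕ} (hl : l < K) {m : ℕ → ℕ}
    (hm : ∀ j, m j = 2 ^ (cumulativeScale K (j + 1) - cumulativeScale K j)) :
    2 * m l ^ 2 * ∏ j ∈ Finset.Ico (l + 1) K, 28 * m l * m j ≤ 2 ^ (K ^ 2 + 6 * K) := by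
  have hgK : cumulativeScale K K = K ^ 2 := by simp [cumulativeScale]
  obtain ⟨r, rfl⟩ : ∃ r, K = l + 1 + r := ⟨K - (l + 1), by omega⟩
  set K := l + 1 + r with hK
  have h1 : cumulativeScale K l ≤ cumulativeScale K (l + 1) := cumulativeScale_mono K (by omega)
  have h2 : cumulativeScale K (l + 1) ≤ K ^ 2 := hgK ▸ cumulativeScale_mono K (by omega)
  have h3 : (r + 1) * cumulativeScale K (l + 1) ≤ K ^ 2 := by
    have : K - (l + 1) + 1 = r + 1 := by omega
    rw [cumulativeScale, this]
    exact Nat.mul_div_le _ _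
  have h4 : K ^ 2 < (r + 2) * (cumulativeScale K l + 1) := by
    have : K - l + 1 = r + 2 := by omega
    rw [cumulativeScale, this]
    exact Nat.lt_mul_div_succ _ (by omega)
  have hprod : ∏ j ∈ Finset.Ico (l + 1) K, m j = 2 ^ (K ^ 2 - cumulativeScale K (l + 1)) := by
    simp only [hm]
    rw [prod_two_pow_sub (cumulativeScale_mono K) (by omega), hgK]
  rw [Finset.prod_mul_distrib, Finset.prod_const, hprod, Nat.card_Ico, hm l]
  have hcard : K - (l + 1) = r := by omega
  rw [hcard]
  obtain ⟨i, hi⟩ := Nat.exists_eq_add_of_le h1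
  obtain ⟨e, he⟩ := Nat.exists_eq_add_of_le h2
  have hi' : cumulativeScale K (l + 1) - cumulativeScale K l = i := by omega
  have he' : K ^ 2 - cumulativeScale K (l + 1) = e := by omega
  rw [hi', he']
  calc 2 * (2 ^ i) ^ 2 * ((28 * 2 ^ i) ^ r * 2 ^ e)
      ≤ 2 * (2 ^ i) ^ 2 * ((2 ^ 5 * 2 ^ i) ^ r * 2 ^ e) := by gcongr; norm_num
    _ = 2 ^ (1 + 2 * i + (5 + i) * r + e) := by
      rw [← pow_add 2 5 i, ← pow_mul, ← pow_mul]; ring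
    _ ≤ 2 ^ (K ^ 2 + 6 * K) := by
      refine Nat.pow_le_pow_right (by norm_num) ?_
      nlinarith

/-- A CPA function with quadratically many maximal pieces, up to lower order terms. -/
lemma exists_cpa_of_scale {K : ℕ} (hK : 1 ≤ K) :
    ∃ (f : ℝ → ℝ) (𝓛 : Finset (ℝ × ℝ)), IsCPA1 f ∧ (∀ x, ∃ L ∈ 𝓛, f x = lineEval L x) ∧
      𝓛.card ≤ 2 ^ (K ^ 2 + 7 * K) ∧
      ∃ Ps : Finset (Set ℝ), (∀ P ∈ Ps, IsMaximalPiece1 f P) ∧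
        2 ^ (2 * (K * (K - 1))) ≤ Ps.card := by
  classical
  set m : ℕ → ℕ := fun j => 2 ^ (cumulativeScale K (j + 1) - cumulativeScale K j) with hm
  have hm1 : ∀ j, 1 ≤ m j := fun j => Nat.one_le_two_pow
  choose A B hAB hmB hB using fun j => exists_pell_solution (m j) (hm1 j)
  obtain ⟨W, C, hinj, hcard, hC, -, hlink⟩ := exists_multiscale m A B hm1 hAB hmB hB K
  have hs : K * (K - 1) + 1 ≤ cumulativeScale K K - cumulativeScale K 0 := by
    have h1 : cumulativeScale K K = K ^ 2 := by simp [cumulativeScale]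
    have h2 : cumulativeScale K 0 < K := by
      rw [cumulativeScale, Nat.div_lt_iff_lt_mul (by omega)]
      simp only [Nat.sub_zero]
      nlinarith
    obtain ⟨k, rfl⟩ : ∃ k, K = k + 1 := ⟨K - 1, by omega⟩
    rw [h1, Nat.add_sub_cancel]
    have : (k + 1) ^ 2 = (k + 1) * k + (k + 1) := by ring
    omega
  have hWcard : 4 * 2 ^ (2 * (K * (K - 1))) ≤ W.card := by
    rw [hcard, Finset.prod_pow, Finset.range_eq_Ico,
      prod_two_pow_sub (cumulativeScale_mono K) (Nat.zero_le K), ← pow_mul]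
    calc 4 * 2 ^ (2 * (K * (K - 1))) = 2 ^ (2 * (K * (K - 1)) + 2) := by rw [pow_add]; ring
      _ ≤ _ := Nat.pow_le_pow_right (by norm_num) (by omega)
  have hpos : 0 < 2 ^ (2 * (K * (K - 1))) := by positivity
  obtain ⟨f, hf, hcomp, Ps, hPs, hPcard⟩ := exists_cpa_of_tentLinked W
    ((Finset.range K).biUnion C) hinj (by omega) fun p q hpq => by
      obtain ⟨l, hl, h⟩ := hlink p q hpq
      refine h.mono (Finset.coe_subset.2 ?_)
      exact Finset.subset_biUnion_of_mem C (Finset.mem_range.2 hl)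
  refine ⟨f, _, hf, hcomp, ?_, Ps, hPs, by omega⟩
  calc ((Finset.range K).biUnion C).card ≤ (Finset.range K).card * 2 ^ (K ^ 2 + 6 * K) :=
        Finset.card_biUnion_le_card_mul _ _ _ fun l hl =>
          (hC l (Finset.mem_range.1 hl)).trans
            (lines_le_two_pow (Finset.mem_range.1 hl) fun _ => rfl)
    _ ≤ 2 ^ K * 2 ^ (K ^ 2 + 6 * K) := by
      rw [Finset.card_range]
      gcongr
      exact Nat.lt_two_pow_self.le
    _ = 2 ^ (K ^ 2 + 7 * K) := by rw [← pow_add]; congr 1; ring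

lemma exists_components {n : ℕ} {f : ℝ → ℝ} {𝓛 : Finset (ℝ × ℝ)}
    (hf : ∀ x, ∃ L ∈ 𝓛, f x = lineEval L x) (h𝓛 : 𝓛.card ≤ n) :
    ∃ g : Fin n → ℝ → ℝ, (∀ i, IsAffineFn1 (g i)) ∧ ∀ x, ∃ i, f x = g i x := by
  refine ⟨fun i => if h : (i : ℕ) < 𝓛.card then lineEval (𝓛.equivFin.symm ⟨i, h⟩ : ℝ × ℝ)
    else lineEval 0, fun i => ?_, fun x => ?_⟩
  · dsimp only
    split_ifs
    · exact ⟨_, _, fun x => rfl⟩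
    · exact ⟨_, _, fun x => rfl⟩
  · obtain ⟨L, hL, h⟩ := hf x
    refine ⟨⟨𝓛.equivFin ⟨L, hL⟩, (𝓛.equivFin ⟨L, hL⟩).2.trans_le h𝓛⟩, ?_⟩
    simp [h]

lemma isMaximalPiece1_univ {f : ℝ → ℝ} (hf : AffineOnSet1 f Set.univ) :
    IsMaximalPiece1 f Set.univ := by
  refine ⟨isOpen_univ, isConnected_univ, hf, ?_⟩
  rintro ⟨U, ⟨u, hu⟩, hU, -⟩
  exact hU hu trivial

lemma rpow_two_sub_div_sqrt_logb {n : ℕ} (hn : 2 ≤ n) (c : ℝ) :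
    (n : ℝ) ^ (2 - c / √(Real.logb 2 n)) =
      2 ^ (2 * √(Real.logb 2 n) ^ 2 - c * √(Real.logb 2 n)) := by
  have hn' : (2 : ℝ) ≤ n := by exact_mod_cast hn
  have hlog : 0 < Real.logb 2 n := Real.logb_pos (by norm_num) (by linarith)
  have hq : 0 < √(Real.logb 2 n) := Real.sqrt_pos.2 hlog
  have hsq : √(Real.logb 2 n) ^ 2 = Real.logb 2 n := Real.sq_sqrt hlog.le
  have hne : (n : ℝ) = 2 ^ (√(Real.logb 2 n) ^ 2) := by
    rw [hsq, Real.rpow_logb (by norm_num) (by norm_num) (by linarith)]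
  generalize √(Real.logb 2 n) = q at *
  rw [hne, ← Real.rpow_mul (by norm_num)]
  congr 1
  field_simp

/-- There are constants `β, c > 0` such that for every `n ≥ 2` there is a
CPA function `f : ℝ → ℝ` with at most `n` affine components and at least
`β · n^(2 - c/√(log₂ n))` pairwise distinct maximal pieces. -/
theorem cpa_one_dim_lower_bound :
    ∃ β c : ℝ, 0 < β ∧ 0 < c ∧ ∀ n : ℕ, 2 ≤ n →
      ∃ f : ℝ → ℝ, IsCPA1 f ∧
        (∃ g : Fin n → ℝ → ℝ, (∀ i, IsAffineFn1 (g i)) ∧ ∀ x, ∃ i, f x = g i x) ∧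
        ∃ Ps : Finset (Set ℝ), (∀ P ∈ Ps, IsMaximalPiece1 f P) ∧
          β * (n : ℝ) ^ (2 - c / Real.sqrt (Real.logb 2 n)) ≤ Ps.card := by
  refine ⟨1, 22, one_pos, by norm_num, fun n hn => ?_⟩
  have hn' : (2 : ℝ) ≤ n := by exact_mod_cast hn
  have hlog : 0 < Real.logb 2 n := Real.logb_pos (by norm_num) (by linarith)
  have hq : 0 < √(Real.logb 2 n) := Real.sqrt_pos.2 hlog
  have hsq : √(Real.logb 2 n) ^ 2 = Real.logb 2 n := Real.sq_sqrt hlog.le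
  simp only [one_mul, rpow_two_sub_div_sqrt_logb hn]
  set q := √(Real.logb 2 n) with hqdef
  rcases lt_or_ge q 5 with h5 | h5
  · have haff : AffineOnSet1 (fun _ => 0) Set.univ := affineOnSet1_of_eq 0 0 0 (by simp)
    refine ⟨fun _ => 0, ⟨continuous_const, {Set.univ}, ?_, by simp⟩,
      exists_components (𝓛 := {0}) (by simp [lineEval]) (by simp; omega),
      {Set.univ}, ?_, ?_⟩
    · simpa using ⟨isConnected_univ, haff⟩
    · simpa using isMaximalPiece1_univ haff
    · rw [Finset.card_singleton, Nat.cast_one]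
      exact Real.rpow_le_one_of_one_le_of_nonpos (by norm_num) (by nlinarith)
  · obtain ⟨K, hK⟩ : ∃ K, ⌊q⌋₊ = K + 4 :=
      ⟨⌊q⌋₊ - 4, by have : 5 ≤ ⌊q⌋₊ := Nat.le_floor (by exact_mod_cast h5)
                    omega⟩
    have hK1 : 1 ≤ K := by
      have : 5 ≤ ⌊q⌋₊ := Nat.le_floor (by exact_mod_cast h5)
      omega
    have hKq : (K : ℝ) + 4 ≤ q := by
      have := Nat.floor_le hq.le
      rw [hK] at this
      exact_mod_cast this
    have hqK : q < (K : ℝ) + 5 := by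
      have := Nat.lt_floor_add_one q
      rw [hK] at this
      push_cast at this
      linarith
    obtain ⟨f, 𝓛, hf, hcomp, hcard, Ps, hPs, hPcard⟩ := exists_cpa_of_scale hK1
    refine ⟨f, hf, exists_components hcomp (hcard.trans ?_), Ps, hPs, ?_⟩
    · have : ((2 ^ (K ^ 2 + 7 * K) : ℕ) : ℝ) ≤ n := by
        push_cast
        rw [← Real.rpow_natCast, ← Real.le_logb_iff_rpow_le (by norm_num) (by linarith), ← hsq]
        push_cast
        nlinarith
      exact_mod_cast this
    · calc (2 : ℝ) ^ (2 * q ^ 2 - 22 * q) ≤ 2 ^ ((2 * (K * (K - 1)) : ℕ) : ℝ) := by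
            refine Real.rpow_le_rpow_of_exponent_le (by norm_num) ?_
            have hK1' : (1 : ℝ) ≤ K := by exact_mod_cast hK1
            push_cast [Nat.cast_sub hK1]
            nlinarith
        _ = ((2 ^ (2 * (K * (K - 1))) : ℕ) : ℝ) := by rw [Real.rpow_natCast]; push_cast; rfl
        _ ≤ Ps.card := by exact_mod_cast hPcard
end

section
/- For every d ≥ 1 there exist real constants α, β, c > 0 such that for every natural number m ≥ 2 there exists a CPA function f_m : ℝ^d → ℝ that has at most α·m affine components (i.e., there exist at most α·m affine functions g_1, …, g_k : ℝ^d → ℝ with: for every x there is i with f_m(x) = g_i(x)) and has at least β · m^{d + 1 − c/√(log₂ m)} pairwise distinct maximal pieces. -/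
open Set Filter Topology

section Affine

variable {d : ℕ} {g g₁ g₂ : (Fin d → ℝ) → ℝ}

theorem IsAffineFn.sub_s6 (h₁ : IsAffineFn g₁) (h₂ : IsAffineFn g₂) :
    IsAffineFn (fun x => g₁ x - g₂ x) := by
  obtain ⟨a₁, b₁, h₁⟩ := h₁
  obtain ⟨a₂, b₂, h₂⟩ := h₂
  refine ⟨a₁ - a₂, b₁ - b₂, fun x => ?_⟩
  simp only [h₁, h₂, Pi.sub_apply, sub_mul, Finset.sum_sub_distrib]
  ring

theorem IsAffineFn.continuous_s6 (h : IsAffineFn g) : Continuous g := by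
  obtain ⟨a, b, h⟩ := h
  rw [funext h]
  fun_prop

theorem IsAffineFn.map_add_smul (h : IsAffineFn g) (x v : Fin d → ℝ) (t : ℝ) :
    g (x + t • v) = g x + t * (g (x + v) - g x) := by
  obtain ⟨a, b, h⟩ := h
  have : ∑ i, a i * (t * v i) = t * ∑ i, a i * v i := by
    rw [Finset.mul_sum]
    exact Finset.sum_congr rfl fun i _ => by ring
  simp only [h, Pi.add_apply, Pi.smul_apply, smul_eq_mul, mul_add, Finset.sum_add_distrib, this]
  ring

theorem IsAffineFn.map_combo_s6 (h : IsAffineFn g) (x y : Fin d → ℝ) {s t : ℝ} (hst : s + t = 1) :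
    g (s • x + t • y) = s * g x + t * g y := by
  have h1 := h.map_add_smul x (y - x) t
  have h2 : x + t • (y - x) = s • x + t • y := by
    obtain rfl : s = 1 - t := by linarith
    module
  rw [h2, add_sub_cancel] at h1
  rw [h1]
  obtain rfl : s = 1 - t := by linarith
  ring

theorem IsAffineFn.dense_ne_zero (h : IsAffineFn g) {z : Fin d → ℝ} (hz : g z ≠ 0) :
    Dense {x | g x ≠ 0} := by
  intro x
  by_cases hx : g x = 0
  · have ht : Tendsto (fun t : ℝ => x + t • (z - x)) (𝓝[≠] 0) (𝓝 x) := by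
      have hc : Continuous (fun t : ℝ => x + t • (z - x)) := by fun_prop
      have := hc.tendsto 0
      simp only [zero_smul, add_zero] at this
      exact this.mono_left nhdsWithin_le_nhds
    refine mem_closure_of_tendsto ht ?_
    filter_upwards [self_mem_nhdsWithin] with t ht0
    have : g (x + t • (z - x)) = t * g z := by
      rw [h.map_add_smul, add_sub_cancel, hx]
      ring
    change g (x + t • (z - x)) ≠ 0
    rw [this]
    exact mul_ne_zero ht0 hz
  · exact subset_closure hx

theorem IsAffineFn.eq_of_eqOn (h₁ : IsAffineFn g₁) (h₂ : IsAffineFn g₂) {U : Set (Fin d → ℝ)}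
    (hU : IsOpen U) (hne : U.Nonempty) (h : EqOn g₁ g₂ U) : g₁ = g₂ := by
  by_contra hcon
  obtain ⟨z, hz⟩ := Function.ne_iff.1 hcon
  obtain ⟨x, hxU, hx⟩ :=
    ((h₁.sub_s6 h₂).dense_ne_zero (sub_ne_zero.2 hz)).inter_open_nonempty U hU hne
  exact hx (sub_eq_zero.2 (h hxU))

theorem IsAffineFn.convex_sign_eq (h : IsAffineFn g) (σ : SignType) :
    Convex ℝ {x | SignType.sign (g x) = σ} := by
  intro x hx y hy s t hs ht hst
  simp only [mem_ofPred_eq] at hx hy ⊢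
  rw [h.map_combo_s6 x y hst]
  have hpos : 0 < s ∨ 0 < t := by
    by_contra hcon
    push Not at hcon
    linarith [hcon.1, hcon.2]
  rcases σ with _ | _ | _
  · change _ = (0 : SignType) at hx
    change _ = (0 : SignType) at hy
    change _ = (0 : SignType)
    rw [sign_eq_zero_iff] at *
    simp [hx, hy]
  · change _ = (-1 : SignType) at hx
    change _ = (-1 : SignType) at hy
    change _ = (-1 : SignType)
    rw [sign_eq_neg_one_iff] at *
    rcases hpos with hp | hp <;> nlinarith
  · change _ = (1 : SignType) at hx
    change _ = (1 : SignType) at hy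
    change _ = (1 : SignType)
    rw [sign_eq_one_iff] at *
    rcases hpos with hp | hp <;> nlinarith

theorem IsAffineFn.isOpen_sign_eq (h : IsAffineFn g) {σ : SignType} (hσ : σ ≠ 0) :
    IsOpen {x | SignType.sign (g x) = σ} := by
  rcases σ with _ | _ | _
  · exact absurd rfl hσ
  · change IsOpen {x | SignType.sign (g x) = (-1 : SignType)}
    simp only [sign_eq_neg_one_iff]
    exact isOpen_lt h.continuous_s6 continuous_const
  · change IsOpen {x | SignType.sign (g x) = (1 : SignType)}
    simp only [sign_eq_one_iff]
    exact isOpen_lt continuous_const h.continuous_s6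

/-- A continuous selection of finitely many affine functions is CPA. -/
theorem isCPA_of_selection {f : (Fin d → ℝ) → ℝ} (hf : Continuous f) {ι : Type*} [Fintype ι]
    {g : ι → (Fin d → ℝ) → ℝ} (hg : ∀ i, IsAffineFn (g i)) (hsel : ∀ x, ∃ i, f x = g i x) :
    IsCPA f := by
  classical
  let cell : (ι → ι → SignType) → Set (Fin d → ℝ) := fun σ =>
    ⋂ i, ⋂ j, {x | SignType.sign (g i x - g j x) = σ i j}
  let good : Set (ι → ι → SignType) := {σ | (cell σ).Nonempty ∧ ∀ i j, g i ≠ g j → σ i j ≠ 0}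
  refine ⟨hf, (Finset.univ.filter (· ∈ good)).image cell, ?_, ?_⟩
  · intro P hP
    obtain ⟨σ, hσ, rfl⟩ := Finset.mem_image.1 hP
    obtain ⟨hne, h0⟩ := (Finset.mem_filter.1 hσ).2
    have hconn : IsPreconnected (cell σ) :=
      (convex_iInter fun i => convex_iInter fun j =>
        ((hg i).sub_s6 (hg j)).convex_sign_eq _).isPreconnected
    refine ⟨?_, ⟨hne, hconn⟩, ?_⟩
    · refine isOpen_iInter_of_finite fun i => isOpen_iInter_of_finite fun j => ?_
      by_cases hij : g i = g j
      · obtain ⟨x, hx⟩ := hne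
        have hx' : SignType.sign (g i x - g j x) = σ i j := by
          simp only [cell, mem_iInter] at hx
          exact hx i j
        have h00 : σ i j = 0 := by rw [← hx', hij]; simp
        simp [hij, h00]
      · exact ((hg i).sub_s6 (hg j)).isOpen_sign_eq (h0 i j hij)
    · obtain ⟨x₀, hx₀⟩ := hne
      obtain ⟨i, hi⟩ := hsel x₀
      refine ⟨g i, hg i, ?_⟩
      have hA : IsClosed {x | f x = g i x} := isClosed_eq hf (hg i).continuous_s6
      have hB : IsClosed (⋃ j, ⋃ (_ : σ i j ≠ 0), {x | f x = g j x}) :=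
        isClosed_iUnion_of_finite fun j => isClosed_iUnion_of_finite fun _ =>
          isClosed_eq hf (hg j).continuous_s6
      have hsign : ∀ x ∈ cell σ, ∀ j, (σ i j = 0 ↔ g i x = g j x) := by
        intro x hx j
        have hx' : SignType.sign (g i x - g j x) = σ i j := by
          simp only [cell, mem_iInter] at hx
          exact hx i j
        rw [← hx', sign_eq_zero_iff, sub_eq_zero]
      rcases isPreconnected_iff_subset_of_disjoint_closed.1 hconn _ _ hA hB
        (by
          intro x hx
          obtain ⟨j, hj⟩ := hsel x
          by_cases h0 : σ i j = 0
          · left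
            change f x = g i x
            rw [hj, (hsign x hx j).1 h0]
          · right
            simp only [mem_iUnion]
            exact ⟨j, h0, hj⟩)
        (by
          rw [eq_empty_iff_forall_notMem]
          rintro x ⟨hx, hxA, hxB⟩
          simp only [mem_iUnion] at hxB
          obtain ⟨j, h0, hj⟩ := hxB
          exact h0 ((hsign x hx j).2 (hxA.symm.trans hj))) with h | h
      · exact h
      · have := h hx₀
        simp only [mem_iUnion] at this
        obtain ⟨j, h0, hj⟩ := this
        exact absurd ((hsign x₀ hx₀ j).2 (hi.symm.trans hj)) h0
  · have hdense : Dense (⋂ p : ι × ι, {x | g p.1 ≠ g p.2 → g p.1 x - g p.2 x ≠ 0}) := by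
      refine dense_iInter_of_isOpen (fun p => ?_) (fun p => ?_)
      · by_cases hp : g p.1 = g p.2
        · simp [hp]
        · simp only [ne_eq, hp, not_false_eq_true, forall_const]
          exact isOpen_ne_fun ((hg _).sub_s6 (hg _)).continuous_s6 continuous_const
      · by_cases hp : g p.1 = g p.2
        · simp [hp]
        · simp only [ne_eq, hp, not_false_eq_true, forall_const]
          obtain ⟨z, hz⟩ := Function.ne_iff.1 hp
          exact ((hg _).sub_s6 (hg _)).dense_ne_zero (sub_ne_zero.2 hz)
    change (⋃ P ∈ (((Finset.univ.filter (· ∈ good)).image cell : Finset _) : Set (Set (Fin d → ℝ))),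
      closure P) = univ
    rw [← (Finset.finite_toSet _).closure_biUnion]
    refine (hdense.mono ?_).closure_eq
    intro x hx
    simp only [mem_iInter, mem_ofPred_eq] at hx
    let σ : ι → ι → SignType := fun i j => SignType.sign (g i x - g j x)
    have hxσ : x ∈ cell σ := by
      simp only [cell, mem_iInter]
      exact fun i j => rfl
    refine mem_biUnion (x := cell σ) ?_ hxσ
    refine Finset.mem_coe.2 (Finset.mem_image_of_mem _ (Finset.mem_filter.2
      ⟨Finset.mem_univ _, ⟨x, hxσ⟩, fun i j hij => ?_⟩))
    exact fun h => hx (i, j) hij (sign_eq_zero_iff.1 h)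

/-- The maximal piece through a point near which `f` agrees with the affine function `g`. -/
theorem isMaximalPiece_connectedComponentIn {f : (Fin d → ℝ) → ℝ} (hg : IsAffineFn g)
    {x : Fin d → ℝ} (hx : x ∈ interior {y | f y = g y}) :
    IsMaximalPiece f (connectedComponentIn (interior {y | f y = g y}) x) := by
  set V := interior {y | f y = g y} with hV
  have hVs : ∀ y ∈ connectedComponentIn V x, f y = g y := fun y hy =>
    interior_subset (s := {y | f y = g y}) (connectedComponentIn_subset V x hy)
  have hopen : IsOpen (connectedComponentIn V x) := isOpen_interior.connectedComponentIn
  have hmem : x ∈ connectedComponentIn V x := mem_connectedComponentIn hx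
  refine ⟨hopen, ⟨⟨x, hmem⟩, isPreconnected_connectedComponentIn⟩,
    ⟨g, hg, hVs⟩, ?_⟩
  rintro ⟨U, ⟨u, hu⟩, hUc, hPU, hconn, g', hg', hfg'⟩
  have hgg : g' = g := hg'.eq_of_eqOn hg hopen ⟨x, hmem⟩ fun y hy => by
    rw [← hfg' y (Or.inl hy)]
    exact hVs y hy
  subst hgg
  have hsub : connectedComponentIn V x ∪ U ⊆ V := interior_maximal hfg' hPU
  exact hUc hu (hconn.isPreconnected.subset_connectedComponentIn (Or.inl hmem) hsub (Or.inr hu))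

end Affine

/-- A sawtooth function: below `-M` at `0, …, m - 1` and above `M` halfway between integers. -/
theorem exists_sawtooth {M : ℝ} (hM : 0 ≤ M) {m : ℕ} (hm : 1 ≤ m) :
    ∃ (s : ℝ → ℝ) (α β : Fin m × Bool → ℝ), Continuous s ∧ (∀ t, ∃ p, s t = α p * t + β p) ∧
      (∀ k : Fin m, s (k : ℝ) < -M) ∧ (∀ k : ℕ, M < s (k + 1 / 2)) ∧ ∀ v, Dense {t | s t ≠ v} := by
  classical
  set A := 4 * M + 6 with hA
  set B := M + 1 with hB
  have hne : (Finset.univ : Finset (Fin m)).Nonempty := ⟨⟨0, hm⟩, Finset.mem_univ _⟩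
  let s : ℝ → ℝ := fun t => Finset.univ.inf' hne fun k : Fin m => A * |t - k| - B
  let α : Fin m × Bool → ℝ := fun p => if p.2 then A else -A
  let β : Fin m × Bool → ℝ := fun p => -(α p * p.1) - B
  have hsel : ∀ t, ∃ p, s t = α p * t + β p := by
    intro t
    obtain ⟨k, -, hk⟩ := Finset.exists_mem_eq_inf' hne fun k : Fin m => A * |t - k| - B
    change s t = _ at hk
    rcases le_total 0 (t - k) with h | h
    · refine ⟨(k, true), ?_⟩
      rw [hk, abs_of_nonneg h]
      simp only [α, β, if_true]
      ring
    · refine ⟨(k, false), ?_⟩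
      rw [hk, abs_of_nonpos h]
      simp only [α, β, Bool.false_eq_true, if_false]
      ring
  refine ⟨s, α, β, ?_, hsel, ?_, ?_, ?_⟩
  · refine Continuous.finset_inf'_apply hne fun k _ => ?_
    fun_prop
  · intro k
    have : s k ≤ A * |(k : ℝ) - k| - B :=
      Finset.inf'_le (fun j : Fin m => A * |((k : ℕ) : ℝ) - j| - B) (Finset.mem_univ k)
    simp only [sub_self, abs_zero, mul_zero] at this
    linarith
  · intro k
    refine (Finset.lt_inf'_iff hne).2 fun j _ => ?_
    have hj : (1 : ℝ) / 2 ≤ |(k : ℝ) + 1 / 2 - (j : ℕ)| := by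
      rcases le_or_gt (j : ℕ) k with h | h
      · have : ((j : ℕ) : ℝ) ≤ k := by exact_mod_cast h
        exact le_trans (by linarith) (le_abs_self _)
      · have : (k : ℝ) + 1 ≤ (j : ℕ) := by exact_mod_cast h
        exact le_trans (by linarith) (neg_le_abs _)
    nlinarith
  · intro v
    have hfin : {t | s t = v}.Finite := by
      refine (Set.finite_range fun p : Fin m × Bool => (v - β p) / α p).subset fun t ht => ?_
      obtain ⟨p, hp⟩ := hsel t
      have hα : α p ≠ 0 := by
        simp only [α]
        split_ifs <;> linarith
      refine ⟨p, ?_⟩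
      change s t = v at ht
      simp only
      rw [div_eq_iff hα]
      linarith
    exact hfin.countable.dense_compl ℝ

theorem exists_cpa_of_path {d : ℕ} (hd : 1 ≤ d) {n T : ℕ} {h : ℝ → ℝ} {a b : Fin n → ℝ}
    {t c e : Fin T → ℝ} (hcont : Continuous h) (hbdd : ∃ M, ∀ x, |h x| ≤ M)
    (hsel : ∀ x, ∃ i, h x = a i * x + b i)
    (hloc : ∀ k, ∀ᶠ x in 𝓝 (t k), h x = c k * x + e k)
    (hsep : ∀ k k', k < k' → ∃ x ∈ Icc (t k) (t k'), h x ≠ c k * x + e k)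
    {m : ℕ} (hm : 1 ≤ m) :
    ∃ f : (Fin d → ℝ) → ℝ, IsCPA f ∧
      (∃ g : Fin (n + d * (m * 2)) → (Fin d → ℝ) → ℝ,
        (∀ i, IsAffineFn (g i)) ∧ ∀ x, ∃ i, f x = g i x) ∧
      ∃ Ps : Finset (Set (Fin d → ℝ)), (∀ P ∈ Ps, IsMaximalPiece f P) ∧
        Ps.card = T * m ^ (d - 1) := by
  classical
  obtain ⟨M, hM⟩ := hbdd
  have hM0 : 0 ≤ M := (abs_nonneg _).trans (hM 0)
  obtain ⟨s, α, β, hs, hssel, hslo, hshi, hsdense⟩ := exists_sawtooth hM0 hm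
  let i₀ : Fin d := ⟨0, hd⟩
  let φ : Fin d → ℝ → ℝ := fun i => if i = i₀ then h else s
  have hφ₀ : φ i₀ = h := if_pos rfl
  have hφ : ∀ i, i ≠ i₀ → φ i = s := fun i hi => if_neg hi
  have hφc : ∀ i, Continuous (φ i) := fun i => by
    by_cases hi : i = i₀
    · rwa [hi, hφ₀]
    · rwa [hφ i hi]
  have hne : (Finset.univ : Finset (Fin d)).Nonempty := ⟨i₀, Finset.mem_univ _⟩
  let f : (Fin d → ℝ) → ℝ := fun x => Finset.univ.sup' hne fun i => φ i (x i)
  have hle : ∀ x i, φ i (x i) ≤ f x := fun x i =>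
    Finset.le_sup' (fun i => φ i (x i)) (Finset.mem_univ i)
  have hex : ∀ x, ∃ i, f x = φ i (x i) := fun x => by
    obtain ⟨i, -, hi⟩ := Finset.exists_mem_eq_sup' hne fun i => φ i (x i)
    exact ⟨i, hi⟩
  have hfc : Continuous f := Continuous.finset_sup'_apply hne fun i _ =>
    (hφc i).comp (continuous_apply i)
  have haff : ∀ (i : Fin d) (p q : ℝ), IsAffineFn fun x : Fin d → ℝ => p * x i + q := by
    intro i p q
    refine ⟨Pi.single i p, q, fun x => ?_⟩
    rw [Finset.sum_eq_single i (fun j _ hj => by simp [hj]) (fun hi => by simp at hi)]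
    simp
  let G : Fin n ⊕ Fin d × (Fin m × Bool) → (Fin d → ℝ) → ℝ := Sum.elim
    (fun i x => a i * x i₀ + b i) (fun q x => α q.2 * x q.1 + β q.2)
  have hG : ∀ q, IsAffineFn (G q) := by
    rintro (i | q)
    · exact haff _ _ _
    · exact haff _ _ _
  have hGsel : ∀ x, ∃ q, f x = G q x := by
    intro x
    obtain ⟨i, hi⟩ := hex x
    by_cases h0 : i = i₀
    · obtain ⟨j, hj⟩ := hsel (x i₀)
      refine ⟨Sum.inl j, ?_⟩
      rw [hi, h0, hφ₀, hj]
      rfl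
    · obtain ⟨p, hp⟩ := hssel (x i)
      refine ⟨Sum.inr (i, p), ?_⟩
      rw [hi, hφ i h0, hp]
      rfl
  refine ⟨f, isCPA_of_selection hfc hG hGsel, ?_, ?_⟩
  · have hcard : Fintype.card (Fin n ⊕ Fin d × (Fin m × Bool)) = n + d * (m * 2) := by simp
    let E := Fintype.equivFinOfCardEq hcard
    refine ⟨fun i => G (E.symm i), fun i => hG _, fun x => ?_⟩
    obtain ⟨q, hq⟩ := hGsel x
    exact ⟨E q, by simpa using hq⟩
  let pt : Fin T × ({i : Fin d // i ≠ i₀} → Fin m) → Fin d → ℝ := fun q i =>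
    if hi : i = i₀ then t q.1 else ((q.2 ⟨i, hi⟩ : ℕ) : ℝ)
  have hpt₀ : ∀ q, pt q i₀ = t q.1 := fun q => dif_pos rfl
  have hpt : ∀ q (i : {i : Fin d // i ≠ i₀}), pt q i = ((q.2 i : ℕ) : ℝ) :=
    fun q i => dif_neg i.2
  let g : Fin T → (Fin d → ℝ) → ℝ := fun k x => c k * x i₀ + e k
  let piece : Fin T × ({i : Fin d // i ≠ i₀} → Fin m) → Set (Fin d → ℝ) := fun q =>
    connectedComponentIn (interior {y | f y = g q.1 y}) (pt q)
  have hmem : ∀ q, pt q ∈ interior {y | f y = g q.1 y} := by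
    intro q
    rw [mem_interior_iff_mem_nhds]
    have h1 : ∀ᶠ y in 𝓝 (pt q), h (y i₀) = c q.1 * y i₀ + e q.1 := by
      have : Tendsto (fun y : Fin d → ℝ => y i₀) (𝓝 (pt q)) (𝓝 (t q.1)) := by
        have := (continuous_apply (A := fun _ : Fin d => ℝ) i₀).tendsto (pt q)
        rwa [hpt₀] at this
      exact this.eventually (hloc q.1)
    have h2 : ∀ᶠ y in 𝓝 (pt q), ∀ i : {i : Fin d // i ≠ i₀}, s (y i) < h (y i₀) := by
      rw [eventually_all]
      intro i
      refine (isOpen_lt (f := fun y : Fin d → ℝ => s (y i)) (g := fun y => h (y i₀))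
        (hs.comp (continuous_apply _)) (hcont.comp (continuous_apply _))).mem_nhds ?_
      change s (pt q i) < h (pt q i₀)
      rw [hpt]
      exact (hslo _).trans_le (abs_le.1 (hM _)).1
    filter_upwards [h1, h2] with y hy1 hy2
    change f y = c q.1 * y i₀ + e q.1
    rw [← hy1]
    obtain ⟨i, hi⟩ := hex y
    by_cases h0 : i = i₀
    · rw [hi, h0, hφ₀]
    · exfalso
      rw [hφ i h0] at hi
      have := hle y i₀
      rw [hφ₀] at this
      linarith [hy2 ⟨i, h0⟩]
  have hpiece : ∀ q, ∀ y ∈ piece q, f y = g q.1 y := fun q y hy =>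
    interior_subset (s := {y | f y = g q.1 y}) (connectedComponentIn_subset _ _ hy)
  have hpath : ∀ q, ∀ y ∈ piece q, f y = h (y i₀) := by
    intro q y hy
    by_contra hcon
    have hlt : h (y i₀) < f y := lt_of_le_of_ne (by simpa only [hφ₀] using hle y i₀) (Ne.symm hcon)
    have hop : IsOpen (piece q) := isOpen_interior.connectedComponentIn
    obtain ⟨ε, hε, hball⟩ := Metric.isOpen_iff.1 hop y hy
    choose w hw hws using fun i => (Metric.dense_iff.1 (hsdense (f y))) (y i) ε hε
    let z : Fin d → ℝ := fun i => if i = i₀ then y i else w i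
    have hz : z ∈ piece q := hball (by
      rw [Metric.mem_ball, dist_pi_lt_iff hε]
      intro i
      by_cases hi : i = i₀
      · simpa [z, hi] using hε
      · simpa [z, hi] using hw i)
    have hz₀ : z i₀ = y i₀ := if_pos rfl
    have hfz : f z = f y := by
      rw [hpiece q z hz, hpiece q y hy]
      simp only [g, hz₀]
    obtain ⟨i, hi⟩ := hex z
    by_cases h0 : i = i₀
    · rw [h0, hφ₀, hz₀] at hi
      linarith
    · have hzi : z i = w i := if_neg h0
      rw [hφ i h0, hzi, hfz] at hi
      exact hws i hi.symm
  have hconn : ∀ q, IsPreconnected (piece q) := fun q => isPreconnected_connectedComponentIn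
  have hIcc : ∀ q (i : Fin d), ∀ y ∈ piece q, ∀ z ∈ piece q, ∀ r ∈ Icc (y i) (z i),
      ∃ u ∈ piece q, u i = r := by
    intro q i y hy z hz r hr
    have := ((hconn q).image (fun u : Fin d → ℝ => u i)
      (continuous_apply i).continuousOn).ordConnected.out
      (mem_image_of_mem _ hy) (mem_image_of_mem _ hz) hr
    exact this
  have hself : ∀ q, pt q ∈ piece q := fun q => mem_connectedComponentIn (hmem q)
  have hk : ∀ q q', piece q = piece q' → ¬ q.1 < q'.1 := by
    intro q q' hqq hlt
    obtain ⟨r, hr, hne'⟩ := hsep _ _ hlt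
    obtain ⟨u, hu, rfl⟩ := hIcc q i₀ (pt q) (hself q) (pt q') (hqq ▸ hself q') r
      (by rwa [hpt₀, hpt₀])
    exact hne' (by rw [← hpath q u hu, hpiece q u hu])
  have hκ : ∀ q q', piece q = piece q' → ∀ i, ¬ q.2 i < q'.2 i := by
    intro q q' hqq i hlt
    have hlt' : ((q.2 i : ℕ) : ℝ) + 1 ≤ (q'.2 i : ℕ) := by exact_mod_cast hlt
    obtain ⟨u, hu, hui⟩ := hIcc q i (pt q) (hself q) (pt q') (hqq ▸ hself q')
      (((q.2 i : ℕ) : ℝ) + 1 / 2) (by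
        rw [hpt, hpt]
        constructor <;> linarith)
    have h1 := hle u i
    rw [hφ i i.2, hui, hpath q u hu] at h1
    linarith [hshi (q.2 i : ℕ), (abs_le.1 (hM (u i₀))).2]
  have hinj : Function.Injective piece := by
    intro q q' hqq
    refine Prod.ext ?_ (funext fun i => ?_)
    · exact le_antisymm (not_lt.1 (hk q' q hqq.symm)) (not_lt.1 (hk q q' hqq))
    · exact le_antisymm (not_lt.1 (hκ q' q hqq.symm i)) (not_lt.1 (hκ q q' hqq i))
  refine ⟨Finset.univ.image piece, ?_, ?_⟩
  · intro P hP
    obtain ⟨q, -, rfl⟩ := Finset.mem_image.1 hP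
    exact isMaximalPiece_connectedComponentIn (haff _ _ _) (hmem q)
  · rw [Finset.card_image_of_injective _ hinj]
    simp [Finset.card_univ]

section Slopes

/-- The embedding `p + q√2` of a lattice point. -/
noncomputable def embX (z : ℕ × ℕ) : ℝ := z.1 + z.2 * √2

/-- The conjugate embedding `p - q√2` of a lattice point. -/
noncomputable def embY (z : ℕ × ℕ) : ℝ := z.1 - z.2 * √2

/-- The lattice square `[0, Q)²`. -/
def latticeBox (Q : ℕ) : Finset (ℕ × ℕ) := Finset.range Q ×ˢ Finset.range Q

/-- Lattice squares of side `Q` meet at most `256 R Q` lines of slope `s`. -/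
def FewLines (R : ℕ) (s : ℝ) : Prop :=
  ∀ Q : ℕ, ((latticeBox Q).image fun z => embY z - s * embX z).card ≤ 256 * R * Q

theorem mul_self_sqrt_two : √2 * √2 = (2 : ℝ) := Real.mul_self_sqrt (by norm_num)

theorem sqrt_two_mem_Ioo : √2 ∈ Ioo (7 / 5 : ℝ) (17 / 12) := by
  constructor
  · exact Real.lt_sqrt_of_sq_lt (by norm_num)
  · exact (Real.sqrt_lt' (by norm_num)).2 (by norm_num)

theorem exists_unit_pow (e : ℕ) : ∃ a b : ℤ,
    (√2 - 1) ^ e = (a : ℝ) + b * √2 ∧ (-(1 + √2)) ^ e = (a : ℝ) - b * √2 := by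
  induction e with
  | zero => exact ⟨1, 0, by simp, by simp⟩
  | succ e ih =>
    obtain ⟨a, b, h1, h2⟩ := ih
    refine ⟨-a + 2 * b, a - b, ?_, ?_⟩
    · rw [pow_succ, h1]
      push_cast
      linear_combination (b : ℝ) * mul_self_sqrt_two
    · rw [pow_succ, h2]
      push_cast
      linear_combination (b : ℝ) * mul_self_sqrt_two

theorem card_image_slope_le (e Q : ℕ) :
    ((((latticeBox Q).image fun z => embY z - (-(1 + √2) ^ 2) ^ e * embX z).card : ℕ) : ℝ) ≤
      4 * (1 + √2) ^ e * Q := by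
  obtain ⟨a, b, h1, h2⟩ := exists_unit_pow e
  obtain ⟨hs1, hs2⟩ := sqrt_two_mem_Ioo
  have hsq := mul_self_sqrt_two
  have hμ1 : 1 ≤ (1 + √2) ^ e := one_le_pow₀ (by linarith)
  have hu0 : 0 < (√2 - 1) ^ e := pow_pos (by linarith) _
  have hu1 : (√2 - 1) ^ e ≤ 1 := pow_le_one₀ (by linarith) (by linarith)
  have hv : |(-(1 + √2)) ^ e| = (1 + √2) ^ e := by
    rw [abs_pow, abs_neg, abs_of_pos (by linarith)]
  have hv' := abs_le.1 hv.le
  have hs : (-(1 + √2) ^ 2) ^ e * (√2 - 1) ^ e = (-(1 + √2)) ^ e := by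
    rw [← mul_pow]
    congr 1
    linear_combination (-1 - √2) * hsq
  have ha : |(a : ℝ)| ≤ (1 + √2) ^ e := by
    rw [abs_le]
    constructor <;> linarith [hv'.1, hv'.2]
  have hb : |(b : ℝ)| ≤ (1 + √2) ^ e := by
    have : |(b : ℝ) * √2| ≤ (1 + √2) ^ e := by
      rw [abs_le]
      constructor <;> linarith [hv'.1, hv'.2]
    rw [abs_mul, abs_of_pos (show 0 < √2 by linarith)] at this
    nlinarith [abs_nonneg (b : ℝ)]
  rcases Nat.eq_zero_or_pos Q with rfl | hQ
  · simp [latticeBox]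
  set H : ℤ := |a| + |b| with hH
  have hH0 : 0 ≤ H := by positivity
  have hHle : (H : ℝ) ≤ 2 * (1 + √2) ^ e := by
    rw [hH]
    push_cast
    linarith
  set B : ℤ := (Q - 1) * H with hB
  have hsub : ((latticeBox Q).image fun z => embY z - (-(1 + √2) ^ 2) ^ e * embX z) ⊆
      (Finset.Icc (-B) B).image fun j : ℤ => 2 * √2 / (√2 - 1) ^ e * j := by
    intro w hw
    obtain ⟨⟨p, q⟩, hz, rfl⟩ := Finset.mem_image.1 hw
    simp only [latticeBox, Finset.mem_product, Finset.mem_range] at hz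
    refine Finset.mem_image.2 ⟨p * b - q * a, ?_, ?_⟩
    · rw [Finset.mem_Icc, ← abs_le]
      have hp : |(p : ℤ)| ≤ Q - 1 := by
        rw [abs_of_nonneg (by positivity)]
        omega
      have hq : |(q : ℤ)| ≤ Q - 1 := by
        rw [abs_of_nonneg (by positivity)]
        omega
      calc |(p : ℤ) * b - q * a| ≤ |(p : ℤ) * b| + |(q : ℤ) * a| := abs_sub _ _
        _ = |(p : ℤ)| * |b| + |(q : ℤ)| * |a| := by rw [abs_mul, abs_mul]
        _ ≤ (Q - 1) * |b| + (Q - 1) * |a| := by gcongr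
        _ = B := by rw [hB, hH]; ring
    · simp only [embX, embY]
      rw [h1] at hu0
      rw [h1, h2] at hs
      rw [h1, div_mul_eq_mul_div, div_eq_iff hu0.ne']
      push_cast
      linear_combination ((p : ℝ) + q * √2) * hs
  have hcard := (Finset.card_le_card hsub).trans Finset.card_image_le
  rw [Int.card_Icc] at hcard
  have hB0 : 0 ≤ B := mul_nonneg (by omega) hH0
  have h3 : ((B + 1 - -B).toNat : ℤ) = 2 * B + 1 := by
    rw [Int.toNat_of_nonneg (by omega)]
    ring
  have h4 : (((B + 1 - -B).toNat : ℕ) : ℝ) = 2 * B + 1 := by exact_mod_cast h3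
  refine (Nat.cast_le.2 hcard).trans ?_
  rw [h4, hB]
  push_cast
  have hQ1 : (1 : ℝ) ≤ Q := by exact_mod_cast hQ
  nlinarith

theorem exists_slopes {R : ℕ} (hR : 1 ≤ R) : ∃ s₁ s₂ : ℝ,
    17 * (R : ℝ) ^ 2 < s₁ ∧ s₂ < -(17 * (R : ℝ) ^ 2) ∧ FewLines R s₁ ∧ FewLines R s₂ := by
  obtain ⟨hs1, hs2⟩ := sqrt_two_mem_Ioo
  have hsq := mul_self_sqrt_two
  have hR1 : (1 : ℝ) ≤ R := by exact_mod_cast hR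
  have hμ4 : (1 + √2) ^ 4 = 17 + 12 * √2 := by
    linear_combination (√2 * √2 + 4 * √2 + 8) * hsq
  obtain ⟨n, hn1, hn2⟩ := exists_nat_pow_near (x := 17 * (R : ℝ) ^ 2) (y := (1 + √2) ^ 4)
    (by nlinarith) (by rw [hμ4]; linarith)
  set P := (1 + √2) ^ (2 * (n + 1)) with hP
  have hP0 : 0 < P := by positivity
  have hPP : ((1 + √2) ^ 4) ^ (n + 1) = P ^ 2 := by
    rw [hP, ← pow_mul, ← pow_mul]
    congr 1
    ring
  have hle : P ^ 2 ≤ 578 * (R : ℝ) ^ 2 := by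
    rw [← hPP, pow_succ]
    have : (1 + √2) ^ 4 ≤ 34 := by rw [hμ4]; linarith
    calc ((1 + √2) ^ 4) ^ n * (1 + √2) ^ 4 ≤ (17 * (R : ℝ) ^ 2) * 34 := by gcongr
      _ = _ := by ring
  have hP25 : P ≤ 25 * R := by nlinarith
  have hPlt : 17 * (R : ℝ) ^ 2 < P ^ 2 := by rwa [← hPP]
  have he1 : (-(1 + √2) ^ 2) ^ (2 * (n + 1)) = P ^ 2 := by
    rw [Even.neg_pow (even_two_mul _), ← pow_mul, hP, ← pow_mul]
    congr 1
    ring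
  have he2 : (-(1 + √2) ^ 2) ^ (2 * (n + 1) + 1) = -(P ^ 2 * (1 + √2) ^ 2) := by
    rw [pow_succ, he1]
    ring
  refine ⟨(-(1 + √2) ^ 2) ^ (2 * (n + 1)), (-(1 + √2) ^ 2) ^ (2 * (n + 1) + 1), ?_, ?_,
    fun Q => ?_, fun Q => ?_⟩
  · rwa [he1]
  · rw [he2]
    have : 1 ≤ (1 + √2) ^ 2 := one_le_pow₀ (by linarith)
    nlinarith
  · have h := card_image_slope_le (2 * (n + 1)) Q
    rw [← hP] at h
    have : 4 * P * Q ≤ ((256 * R * Q : ℕ) : ℝ) := by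
      push_cast
      have : (0 : ℝ) ≤ Q := by positivity
      nlinarith
    exact_mod_cast h.trans this
  · have h := card_image_slope_le (2 * (n + 1) + 1) Q
    rw [pow_succ (1 + √2) (2 * (n + 1)), ← hP] at h
    have : 4 * (P * (1 + √2)) * Q ≤ ((256 * R * Q : ℕ) : ℝ) := by
      push_cast
      have hQ0 : (0 : ℝ) ≤ Q := by positivity
      have : P * (1 + √2) ≤ 25 * R * (29 / 12) := by
        gcongr
        linarith
      nlinarith
    exact_mod_cast h.trans this

end Slopes

section Zigzag

theorem int_eq_zero_of_add_mul_sqrt_two {p q : ℤ} (h : (p : ℝ) + q * √2 = 0) : p = 0 ∧ q = 0 := by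
  by_cases hq : q = 0
  · subst hq
    simpa using h
  · exfalso
    have hq' : (q : ℝ) ≠ 0 := by exact_mod_cast hq
    refine irrational_sqrt_two ⟨(-p : ℚ) / q, ?_⟩
    push_cast
    rw [div_eq_iff hq']
    linarith

theorem one_le_abs_norm {p q : ℤ} (h : (p : ℝ) + q * √2 ≠ 0) :
    1 ≤ |(p : ℝ) + q * √2| * |(p : ℝ) - q * √2| := by
  have h' : (p : ℝ) - q * √2 ≠ 0 := by
    intro h0
    obtain ⟨rfl, hq⟩ := int_eq_zero_of_add_mul_sqrt_two (p := p) (q := -q) (by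
      push_cast
      linarith)
    rw [neg_eq_zero] at hq
    simp [hq] at h
  have hn : ((p : ℝ) + q * √2) * ((p : ℝ) - q * √2) = ((p ^ 2 - 2 * q ^ 2 : ℤ) : ℝ) := by
    push_cast
    linear_combination (-(q : ℝ) ^ 2) * mul_self_sqrt_two
  rw [← abs_mul, hn]
  have h0 : p ^ 2 - 2 * q ^ 2 ≠ 0 := by
    intro h0
    rw [h0, Int.cast_zero] at hn
    exact (mul_ne_zero h h') hn
  exact_mod_cast Int.one_le_abs h0

theorem embX_injective : Function.Injective embX := by
  rintro ⟨p, q⟩ ⟨p', q'⟩ h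
  simp only [embX] at h
  obtain ⟨h1, h2⟩ := int_eq_zero_of_add_mul_sqrt_two (p := p - p') (q := q - q') (by
    push_cast
    linarith)
  exact Prod.ext (by simp only; omega) (by simp only; omega)

/-- Enumeration of a lattice square by increasing `embX`. -/
theorem exists_sorted_box {R : ℕ} (hR : 1 ≤ R) : ∃ z : ℕ → ℕ × ℕ,
    (∀ a, z a ∈ latticeBox R) ∧ ∀ a, a + 1 < R ^ 2 →
      2 / 5 / (R : ℝ) ≤ embX (z (a + 1)) - embX (z a) ∧
      |embY (z (a + 1)) - embY (z a)| ≤ 5 / 2 * R := by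
  have hR1 : (1 : ℝ) ≤ R := by exact_mod_cast hR
  obtain ⟨hs1, hs2⟩ := sqrt_two_mem_Ioo
  have hcard : ((latticeBox R).image embX).card = R ^ 2 := by
    rw [Finset.card_image_of_injective _ embX_injective]
    simp [latticeBox, sq]
  let E := ((latticeBox R).image embX).orderEmbOfFin hcard
  have hE : ∀ a : ℕ, ∃ z ∈ latticeBox R, ∀ h : a < R ^ 2, embX z = E ⟨a, h⟩ := by
    intro a
    by_cases h : a < R ^ 2
    · obtain ⟨z, hz, hzE⟩ := Finset.mem_image.1
        (((latticeBox R).image embX).orderEmbOfFin_mem hcard ⟨a, h⟩)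
      exact ⟨z, hz, fun _ => hzE⟩
    · exact ⟨(0, 0), by simp [latticeBox]; omega, fun h' => absurd h' h⟩
  choose z hz hzE using hE
  refine ⟨z, hz, fun a ha => ?_⟩
  have hlt : embX (z a) < embX (z (a + 1)) := by
    rw [hzE a (by omega), hzE (a + 1) ha]
    exact E.strictMono (Fin.mk_lt_mk.2 (Nat.lt_succ_self a))
  have hb := hz a
  have hb' := hz (a + 1)
  generalize z a = w at hlt hb
  generalize z (a + 1) = w' at hlt hb'
  obtain ⟨p, q⟩ := w
  obtain ⟨p', q'⟩ := w'
  simp only [latticeBox, Finset.mem_product, Finset.mem_range] at hb hb'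
  have hX : embX (p', q') - embX (p, q) =
      (((p' : ℤ) - p : ℤ) : ℝ) + (((q' : ℤ) - q : ℤ) : ℝ) * √2 := by
    simp only [embX]
    push_cast
    ring
  have hY : embY (p', q') - embY (p, q) =
      (((p' : ℤ) - p : ℤ) : ℝ) - (((q' : ℤ) - q : ℤ) : ℝ) * √2 := by
    simp only [embY]
    push_cast
    ring
  have hp : |(((p' : ℤ) - p : ℤ) : ℝ)| ≤ R := by
    have : |(p' : ℤ) - p| ≤ R := by
      rw [abs_le]
      omega
    exact_mod_cast this
  have hq : |(((q' : ℤ) - q : ℤ) : ℝ)| ≤ R := by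
    have : |(q' : ℤ) - q| ≤ R := by
      rw [abs_le]
      omega
    exact_mod_cast this
  have hnorm := one_le_abs_norm (p := (p' : ℤ) - p) (q := (q' : ℤ) - q) (by
    rw [← hX]
    linarith)
  rw [← hX, ← hY] at hnorm
  have hYle : |embY (p', q') - embY (p, q)| ≤ 5 / 2 * R := by
    rw [hY]
    calc _ ≤ |(((p' : ℤ) - p : ℤ) : ℝ)| + |(((q' : ℤ) - q : ℤ) : ℝ) * √2| := abs_sub _ _
      _ = |(((p' : ℤ) - p : ℤ) : ℝ)| + |(((q' : ℤ) - q : ℤ) : ℝ)| * √2 := by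
        rw [abs_mul, abs_of_pos (show (0 : ℝ) < √2 by linarith)]
      _ ≤ R + R * (17 / 12) := by gcongr
      _ ≤ 5 / 2 * R := by linarith
  refine ⟨?_, hYle⟩
  rw [abs_of_pos (by linarith : 0 < embX (p', q') - embX (p, q))] at hnorm
  rw [div_le_iff₀ (by linarith)]
  nlinarith

/-- Consecutive points `(x k, y k)`, `k < T`, are joined by a steep line through the left one and
a less steep line through the right one, both belonging to a common class `L c`, `c < n`. -/
def IsZigzag (n T : ℕ) (x y : ℕ → ℝ) (L : ℕ → Finset (ℝ × ℝ)) : Prop :=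
  ∀ k, k + 1 < T → x k < x (k + 1) ∧ ∃ c < n, ∃ p ∈ L c, ∃ q ∈ L c,
    y k = p.1 * x k + p.2 ∧ y (k + 1) = q.1 * x (k + 1) + q.2 ∧
    q.1 * (x (k + 1) - x k) < y (k + 1) - y k ∧ y (k + 1) - y k < p.1 * (x (k + 1) - x k)

theorem FewLines.card_le {R : ℕ} {s : ℝ} (h : FewLines R s) (Q : ℕ) (κ : ℝ) :
    ((latticeBox Q).image fun z => (s, embY z - s * embX z + κ)).card ≤ 256 * R * Q := by
  have : ((latticeBox Q).image fun z => (s, embY z - s * embX z + κ)) =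
      ((latticeBox Q).image fun z => embY z - s * embX z).image fun u => (s, u + κ) := by
    rw [Finset.image_image]
    rfl
  rw [this]
  exact Finset.card_image_le.trans (h Q)

theorem exists_zigzag {R : ℕ → ℕ} (hR : ∀ i, 1 ≤ R i) (n : ℕ) :
    ∃ (x y : ℕ → ℝ) (L : ℕ → Finset (ℝ × ℝ)),
      IsZigzag n (∏ i ∈ Finset.range n, R i ^ 2) x y L ∧
      ∀ c < n, (L c).card ≤ 2 * ∏ i ∈ Finset.Ico c n, 256 * R c * R i ∧
        ∀ p ∈ L c, FewLines (R c) p.1 := by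
  induction n with
  | zero => exact ⟨0, 0, fun _ => ∅, fun k hk => by simp at hk, fun c hc => by omega⟩
  | succ n ih =>
    obtain ⟨x, y, L, hzz, hL⟩ := ih
    set T := ∏ i ∈ Finset.range n, R i ^ 2 with hT
    have hT1 : 0 < T := Finset.prod_pos fun i _ => pow_pos (hR i) 2
    obtain ⟨z, hz, hgap⟩ := exists_sorted_box (hR n)
    obtain ⟨s₁, s₂, hs₁, hs₂, hf₁, hf₂⟩ := exists_slopes (hR n)
    have hR1 : (1 : ℝ) ≤ R n := by exact_mod_cast hR n
    obtain ⟨δ, hδ, hδx, hδy⟩ : ∃ δ > 0, δ * |x (T - 1) - x 0| ≤ 1 / 10 / R n ∧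
        δ * |y (T - 1) - y 0| ≤ 1 / 10 / R n := by
      have h1 := abs_nonneg (x (T - 1) - x 0)
      have h2 := abs_nonneg (y (T - 1) - y 0)
      have hpos : 0 < 1 + |x (T - 1) - x 0| + |y (T - 1) - y 0| := by positivity
      refine ⟨1 / 10 / R n / (1 + |x (T - 1) - x 0| + |y (T - 1) - y 0|), by positivity, ?_, ?_⟩
      · rw [div_mul_eq_mul_div, div_le_iff₀ hpos]
        exact mul_le_mul_of_nonneg_left (by linarith) (by positivity)
      · rw [div_mul_eq_mul_div, div_le_iff₀ hpos]
        exact mul_le_mul_of_nonneg_left (by linarith) (by positivity)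
    let Lₙ : Finset (ℝ × ℝ) :=
      ((latticeBox (R n)).image fun w =>
        (s₁, embY w - s₁ * embX w + δ * (y (T - 1) - s₁ * x (T - 1)))) ∪
      (latticeBox (R n)).image fun w => (s₂, embY w - s₂ * embX w + δ * (y 0 - s₂ * x 0))
    let L' : ℕ → Finset (ℝ × ℝ) := fun c => if c = n then Lₙ else
      (L c).biUnion fun p => (latticeBox (R n)).image fun w =>
        (p.1, embY w - p.1 * embX w + δ * p.2)
    have hL'n : L' n = Lₙ := if_pos rfl
    have hL'c : ∀ c, c < n → L' c = (L c).biUnion fun p => (latticeBox (R n)).image fun w =>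
        (p.1, embY w - p.1 * embX w + δ * p.2) := fun c hc => if_neg hc.ne
    refine ⟨fun k => embX (z (k / T)) + δ * x (k % T), fun k => embY (z (k / T)) + δ * y (k % T),
      L', ?_, ?_⟩
    · intro k hk
      rw [Finset.prod_range_succ, ← hT] at hk
      have hkT := Nat.div_add_mod k T
      have hlt := Nat.mod_lt k hT1
      obtain ⟨a, ha⟩ : ∃ a, k / T = a := ⟨_, rfl⟩
      obtain ⟨r, hr⟩ : ∃ r, k % T = r := ⟨_, rfl⟩
      rw [ha, hr] at hkT
      rw [hr] at hlt
      by_cases hin : r + 1 < T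
      · have hdm : (k + 1) / T = a ∧ (k + 1) % T = r + 1 := by
          have : k + 1 = r + 1 + T * a := by omega
          constructor
          · rw [this, Nat.add_mul_div_left _ _ hT1, Nat.div_eq_of_lt hin, zero_add]
          · rw [this, Nat.add_mul_mod_self_left, Nat.mod_eq_of_lt hin]
        obtain ⟨hx, c, hc, p, hp, q, hq, hyp, hyq, h1, h2⟩ := hzz r hin
        simp only [ha, hr, hdm.1, hdm.2]
        refine ⟨by nlinarith, c, by omega, (p.1, embY (z a) - p.1 * embX (z a) + δ * p.2), ?_,
          (q.1, embY (z a) - q.1 * embX (z a) + δ * q.2), ?_, ?_, ?_, ?_, ?_⟩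
        · rw [hL'c c hc]
          exact Finset.mem_biUnion.2 ⟨p, hp, Finset.mem_image_of_mem _ (hz a)⟩
        · rw [hL'c c hc]
          exact Finset.mem_biUnion.2 ⟨q, hq, Finset.mem_image_of_mem _ (hz a)⟩
        · rw [hyp]
          ring
        · rw [hyq]
          ring
        · have := mul_lt_mul_of_pos_left h1 hδ
          simp only
          linarith
        · have := mul_lt_mul_of_pos_left h2 hδ
          simp only
          linarith
      · have hr' : r = T - 1 := by omega
        have hk1 : k + 1 = T * (a + 1) := by
          rw [mul_add]
          omega
        have hdm : (k + 1) / T = a + 1 ∧ (k + 1) % T = 0 := by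
          rw [hk1]
          exact ⟨Nat.mul_div_cancel_left _ hT1, Nat.mul_mod_right _ _⟩
        have ha1 : a + 1 < R n ^ 2 := by
          rw [hk1] at hk
          exact lt_of_mul_lt_mul_left hk hT1.le
        simp only [ha, hr, hdm.1, hdm.2, hr']
        obtain ⟨hgx, hgy⟩ := hgap a ha1
        have hinv : (0 : ℝ) < 1 / R n := by positivity
        have hinv1 : (1 : ℝ) / R n ≤ R n := by
          rw [div_le_iff₀ (by linarith)]
          nlinarith
        have hRR : (R n : ℝ) ^ 2 * (1 / R n) = R n := by
          field_simp
        have hgx' : 2 / 5 * (1 / (R n : ℝ)) ≤ embX (z (a + 1)) - embX (z a) := by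
          rwa [mul_one_div]
        have e1 : |δ * (x (T - 1) - x 0)| ≤ 1 / 10 * (1 / R n) := by
          rwa [abs_mul, abs_of_pos hδ, mul_one_div]
        have e2 : |δ * (y (T - 1) - y 0)| ≤ 1 / 10 * (1 / R n) := by
          rwa [abs_mul, abs_of_pos hδ, mul_one_div]
        have hΔx : 3 / 10 * (1 / (R n : ℝ)) ≤
            embX (z (a + 1)) + δ * x 0 - (embX (z a) + δ * x (T - 1)) := by
          linarith [(abs_le.1 e1).2]
        have hΔy : |embY (z (a + 1)) + δ * y 0 - (embY (z a) + δ * y (T - 1))| ≤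
            26 / 10 * R n := by
          have g1 := abs_le.1 hgy
          have g2 := abs_le.1 e2
          rw [abs_le]
          constructor <;> linarith [g1.1, g1.2, g2.1, g2.2]
        set Δx := embX (z (a + 1)) + δ * x 0 - (embX (z a) + δ * x (T - 1))
        set Δy := embY (z (a + 1)) + δ * y 0 - (embY (z a) + δ * y (T - 1))
        have hprod : 51 / 10 * (R n : ℝ) ≤ 17 * (R n : ℝ) ^ 2 * Δx := by
          have := mul_le_mul_of_nonneg_left hΔx (show (0 : ℝ) ≤ 17 * (R n : ℝ) ^ 2 by positivity)
          linarith
        have hΔx0 : 0 < Δx := by linarith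
        have hΔy' := abs_le.1 hΔy
        refine ⟨sub_pos.1 hΔx0, n, n.lt_succ_self,
          (s₁, embY (z a) - s₁ * embX (z a) + δ * (y (T - 1) - s₁ * x (T - 1))), ?_,
          (s₂, embY (z (a + 1)) - s₂ * embX (z (a + 1)) + δ * (y 0 - s₂ * x 0)), ?_,
          ?_, ?_, ?_, ?_⟩
        · rw [hL'n]
          exact Finset.mem_union_left _ (Finset.mem_image_of_mem _ (hz a))
        · rw [hL'n]
          exact Finset.mem_union_right _ (Finset.mem_image_of_mem _ (hz (a + 1)))
        · ring
        · ring
        · have := mul_lt_mul_of_pos_right hs₂ hΔx0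
          simp only
          linarith [hΔy'.1]
        · have := mul_lt_mul_of_pos_right hs₁ hΔx0
          simp only
          linarith [hΔy'.2]
    · intro c hc
      rcases Nat.lt_succ_iff_lt_or_eq.1 hc with hc | rfl
      · obtain ⟨hcard, hfew⟩ := hL c hc
        rw [hL'c c hc]
        constructor
        · rw [Finset.prod_Ico_succ_top hc.le, ← mul_assoc]
          refine (Finset.card_biUnion_le_card_mul _ _ _ fun p hp =>
            (hfew p hp).card_le (R n) (δ * p.2)).trans ?_
          exact Nat.mul_le_mul_right _ hcard
        · intro p hp
          obtain ⟨q, hq, hpq⟩ := Finset.mem_biUnion.1 hp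
          obtain ⟨w, -, rfl⟩ := Finset.mem_image.1 hpq
          exact hfew q hq
      · rw [hL'n]
        constructor
        · rw [Nat.Ico_succ_singleton, Finset.prod_singleton, two_mul]
          exact (Finset.card_union_le _ _).trans
            (Nat.add_le_add (hf₁.card_le _ _) (hf₂.card_le _ _))
        · intro p hp
          rcases Finset.mem_union.1 hp with hp | hp
          · obtain ⟨w, -, rfl⟩ := Finset.mem_image.1 hp
            exact hf₁
          · obtain ⟨w, -, rfl⟩ := Finset.mem_image.1 hp
            exact hf₂

end Zigzag

theorem exists_path_of_points {T : ℕ} (hT : 1 ≤ T) {x y : ℕ → ℝ} {S : Finset (ℝ × ℝ)}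
    (hS : ∀ k, k + 1 < T → x k < x (k + 1) ∧ ∃ p ∈ S, ∃ q ∈ S,
      y k = p.1 * x k + p.2 ∧ y (k + 1) = q.1 * x (k + 1) + q.2 ∧
      q.1 * (x (k + 1) - x k) < y (k + 1) - y k ∧ y (k + 1) - y k < p.1 * (x (k + 1) - x k)) :
    ∃ (h : ℝ → ℝ) (t c e : Fin T → ℝ), Continuous h ∧ (∃ M, ∀ u, |h u| ≤ M) ∧
      (∀ u, ∃ p ∈ insert (0, y 0) (insert (0, y (T - 1)) S), h u = p.1 * u + p.2) ∧
      (∀ k, ∀ᶠ u in 𝓝 (t k), h u = c k * u + e k) ∧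
      ∀ k k', k < k' → ∃ u ∈ Icc (t k) (t k'), h u ≠ c k * u + e k := by
  have hmono : ∀ k l, k ≤ l → l < T → x k ≤ x l := by
    intro k l hkl
    induction l, hkl using Nat.le_induction with
    | base => exact fun _ => le_rfl
    | succ l _ ih => exact fun hl => (ih (by omega)).trans (hS l hl).1.le
  have hS' : ∀ k, ∃ p q : ℝ × ℝ, k + 1 < T → p ∈ S ∧ q ∈ S ∧
      y k = p.1 * x k + p.2 ∧ y (k + 1) = q.1 * x (k + 1) + q.2 ∧
      y k < q.1 * x k + q.2 ∧ y (k + 1) < p.1 * x (k + 1) + p.2 := by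
    intro k
    by_cases hk : k + 1 < T
    · obtain ⟨-, p, hp, q, hq, h1, h2, h3, h4⟩ := hS k hk
      exact ⟨p, q, fun _ => ⟨hp, hq, h1, h2, by linarith, by linarith⟩⟩
    · exact ⟨0, 0, fun h => absurd h hk⟩
  choose p q hpq using hS'
  let G : ℕ → ℝ → ℝ := fun k u => min ((p k).1 * u + (p k).2) ((q k).1 * u + (q k).2)
  have hG₁ : ∀ k, k + 1 < T → G k (x k) = y k := by
    intro k hk
    obtain ⟨-, -, h1, -, h3, -⟩ := hpq k hk
    simp only [G]
    rw [← h1, min_eq_left h3.le]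
  have hG₂ : ∀ k, k + 1 < T → G k (x (k + 1)) = y (k + 1) := by
    intro k hk
    obtain ⟨-, -, -, h2, -, h4⟩ := hpq k hk
    simp only [G]
    rw [← h2, min_eq_right h4.le]
  have hGc : ∀ k, Continuous (G k) := fun k => by fun_prop
  have hbuild : ∀ n, n < T → ∃ h : ℝ → ℝ, Continuous h ∧ (∀ u ≤ x 0, h u = y 0) ∧
      (∀ u, x n ≤ u → h u = y n) ∧ ∀ k < n, ∀ u ∈ Icc (x k) (x (k + 1)), h u = G k u := by
    intro n
    induction n with
    | zero => exact fun _ => ⟨fun _ => y 0, continuous_const, fun _ _ => rfl, fun _ _ => rfl,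
        fun k hk => by omega⟩
    | succ n ih =>
      intro hn
      obtain ⟨h, hc, h0, hlast, hmid⟩ := ih (by omega)
      have hxn := (hS n hn).1
      refine ⟨fun u => if u ≤ x n then h u else G n (min u (x (n + 1))), ?_, ?_, ?_, ?_⟩
      · refine hc.if_le ((hGc n).comp (continuous_id.min continuous_const)) continuous_id
          continuous_const ?_
        rintro u rfl
        rw [hlast _ le_rfl, min_eq_left hxn.le, hG₁ n hn]
      · intro u hu
        simp only
        rw [if_pos (hu.trans (hmono 0 n n.zero_le (by omega))), h0 u hu]
      · intro u hu
        simp only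
        rw [if_neg (by linarith), min_eq_right hu, hG₂ n hn]
      · intro k hk u hu
        simp only
        rcases Nat.lt_succ_iff_lt_or_eq.1 hk with hk | rfl
        · rw [if_pos (hu.2.trans (hmono _ _ hk (by omega))), hmid k hk u hu]
        · split_ifs with hle
          · obtain rfl : u = x k := le_antisymm hle hu.1
            rw [hlast _ le_rfl, hG₁ k hn]
          · rw [min_eq_left hu.2]
  obtain ⟨h, hc, h0, hlast, hmid⟩ := hbuild (T - 1) (by omega)
  have hcover : ∀ u n, u ≤ x n → u ≤ x 0 ∨ ∃ k < n, u ∈ Icc (x k) (x (k + 1)) := by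
    intro u n
    induction n with
    | zero => exact Or.inl
    | succ n ih =>
      intro hu
      rcases le_total u (x n) with hun | hun
      · exact (ih hun).imp_right fun ⟨k, hk, hku⟩ => ⟨k, by omega, hku⟩
      · exact Or.inr ⟨n, n.lt_succ_self, hun, hu⟩
  have hval : ∀ k, k + 1 < T → h (x (k + 1)) = y (k + 1) := fun k hk => by
    rw [hmid k (by omega) _ ⟨(hS k hk).1.le, le_rfl⟩, hG₂ k hk]
  have hloc : ∀ k : Fin T, ∃ t c e : ℝ, x k < t ∧ (∀ᶠ u in 𝓝 t, h u = c * u + e) ∧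
      ((k : ℕ) + 1 < T → t ≤ x (k + 1) ∧ h (x (k + 1)) ≠ c * x (k + 1) + e) := by
    intro k
    by_cases hk : (k : ℕ) + 1 < T
    · obtain ⟨-, -, h1, h2, h3, h4⟩ := hpq k hk
      have hopen : IsOpen {u : ℝ | (p k).1 * u + (p k).2 < (q k).1 * u + (q k).2} :=
        isOpen_lt (by fun_prop) (by fun_prop)
      have hmem : x k ∈ {u : ℝ | (p k).1 * u + (p k).2 < (q k).1 * u + (q k).2} := by
        change (p k).1 * x k + (p k).2 < (q k).1 * x k + (q k).2
        rwa [← h1]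
      obtain ⟨t, ht, ht'⟩ := Filter.nonempty_of_mem (inter_mem
        (mem_nhdsWithin_of_mem_nhds (hopen.mem_nhds hmem)) (Ioo_mem_nhdsGT (hS k hk).1))
      refine ⟨t, (p k).1, (p k).2, ht'.1, ?_, fun _ => ⟨ht'.2.le, ?_⟩⟩
      · filter_upwards [hopen.mem_nhds ht, Ioo_mem_nhds ht'.1 ht'.2] with u hu hu'
        rw [hmid k (by omega) u ⟨hu'.1.le, hu'.2.le⟩]
        exact min_eq_left (le_of_lt hu)
      · rw [hval k hk]
        exact h4.ne
    · have hkT : (k : ℕ) = T - 1 := by omega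
      refine ⟨x k + 1, 0, y (T - 1), by linarith, ?_, fun hk' => absurd hk' hk⟩
      filter_upwards [Ioi_mem_nhds (show x k < x k + 1 by linarith)] with u hu
      rw [hlast u (hkT ▸ le_of_lt hu), zero_mul, zero_add]
  choose t c e ht hev hsep using hloc
  refine ⟨h, t, c, e, hc, ?_, ?_, hev, ?_⟩
  · obtain ⟨M, hM⟩ := (isCompact_Icc (a := x 0) (b := x (T - 1))).exists_bound_of_continuousOn
      hc.continuousOn
    have h0T : x 0 ≤ x (T - 1) := hmono 0 _ (Nat.zero_le _) (by omega)
    refine ⟨M, fun u => ?_⟩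
    rw [← Real.norm_eq_abs]
    rcases le_total u (x 0) with hu | hu
    · rw [h0 u hu, ← h0 (x 0) le_rfl]
      exact hM _ ⟨le_rfl, h0T⟩
    · rcases le_total u (x (T - 1)) with hu' | hu'
      · exact hM u ⟨hu, hu'⟩
      · rw [hlast u hu', ← hlast _ le_rfl]
        exact hM _ ⟨h0T, le_rfl⟩
  · intro u
    rcases le_total u (x (T - 1)) with hu | hu
    · rcases hcover u _ hu with hu | ⟨k, hk, hku⟩
      · exact ⟨(0, y 0), by simp, by rw [h0 u hu]; simp⟩
      · obtain ⟨hp, hq, -⟩ := hpq k (by omega)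
        rw [hmid k hk u hku]
        rcases min_choice ((p k).1 * u + (p k).2) ((q k).1 * u + (q k).2) with hm | hm
        · exact ⟨p k, by simp [hp], hm⟩
        · exact ⟨q k, by simp [hq], hm⟩
    · exact ⟨(0, y (T - 1)), by simp, by rw [hlast u hu]; simp⟩
  · intro k k' hkk
    have hkk' : (k : ℕ) < k' := hkk
    obtain ⟨h1, h2⟩ := hsep k (by omega)
    exact ⟨x (k + 1), ⟨h1, (hmono _ _ hkk' k'.2).trans (ht k').le⟩, h2⟩

theorem sum_levelExponent (N j : ℕ) (hj : j ≤ N) :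
    ((∑ i ∈ Finset.Ico (N - j) N, N ^ 2 / ((N - i) * (N - i + 1)) : ℕ) : ℝ) ≤
        (N : ℝ) ^ 2 * (1 - 1 / (j + 1)) ∧
      (N : ℝ) ^ 2 * (1 - 1 / (j + 1)) - j ≤
        ((∑ i ∈ Finset.Ico (N - j) N, N ^ 2 / ((N - i) * (N - i + 1)) : ℕ) : ℝ) := by
  induction j with
  | zero => simp
  | succ j ih =>
    obtain ⟨h1, h2⟩ := ih (by omega)
    rw [Finset.sum_eq_sum_Ico_succ_bot (by omega), show N - (j + 1) + 1 = N - j by omega,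
      show N - (N - (j + 1)) = j + 1 by omega]
    push_cast at h1 h2 ⊢
    have hd : (1 : ℝ) / (((j : ℝ) + 1) * (j + 1 + 1)) = 1 / (j + 1) - 1 / (j + 1 + 1) := by
      field_simp
      ring
    have hup : ((N ^ 2 / ((j + 1) * (j + 1 + 1)) : ℕ) : ℝ) ≤
        (N : ℝ) ^ 2 * (1 / (((j : ℝ) + 1) * (j + 1 + 1))) := by
      rw [mul_one_div]
      exact_mod_cast Nat.cast_div_le (α := ℝ) (m := N ^ 2) (n := (j + 1) * (j + 1 + 1))
    have hlo : (N : ℝ) ^ 2 * (1 / (((j : ℝ) + 1) * (j + 1 + 1))) ≤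
        ((N ^ 2 / ((j + 1) * (j + 1 + 1)) : ℕ) : ℝ) + 1 := by
      rw [mul_one_div, div_le_iff₀ (by positivity), mul_comm]
      exact_mod_cast (Nat.lt_mul_div_succ (N ^ 2)
        (show 0 < (j + 1) * (j + 1 + 1) by positivity)).le
    rw [hd] at hup hlo
    constructor <;> linarith

theorem exists_path (N : ℕ) : ∃ (n T : ℕ) (h : ℝ → ℝ) (a b : Fin n → ℝ) (t c e : Fin T → ℝ),
    n ≤ 2 ^ (N ^ 2 + 9 * N + 1) ∧ 2 ^ (2 * N ^ 2) ≤ T * 2 ^ (4 * N) ∧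
      Continuous h ∧ (∃ M, ∀ u, |h u| ≤ M) ∧ (∀ u, ∃ i, h u = a i * u + b i) ∧
      (∀ k, ∀ᶠ u in 𝓝 (t k), h u = c k * u + e k) ∧
      ∀ k k', k < k' → ∃ u ∈ Icc (t k) (t k'), h u ≠ c k * u + e k := by
  classical
  let r : ℕ → ℕ := fun i => N ^ 2 / ((N - i) * (N - i + 1))
  obtain ⟨x, y, L, hzz, hL⟩ :=
    exists_zigzag (R := fun i => 2 ^ r i) (fun i => Nat.one_le_two_pow) N
  have hT : ∏ i ∈ Finset.range N, (2 ^ r i) ^ 2 = 2 ^ (2 * ∑ i ∈ Finset.range N, r i) := by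
    rw [mul_comm, pow_mul, ← Finset.prod_pow_eq_pow_sum, Finset.prod_pow]
  rw [hT] at hzz
  have hcard : ∀ c < N, (L c).card ≤ 2 ^ (N ^ 2 + 8 * N + 1) := by
    intro c hc
    refine (hL c hc).1.trans ?_
    have hprod : ∏ i ∈ Finset.Ico c N, 256 * 2 ^ r c * 2 ^ r i =
        2 ^ (8 * (N - c) + (N - c) * r c + ∑ i ∈ Finset.Ico c N, r i) := by
      rw [Finset.prod_mul_distrib, Finset.prod_const, Nat.card_Ico, pow_add,
        Finset.prod_pow_eq_pow_sum, pow_add, mul_pow, ← pow_mul, mul_comm (r c),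
        pow_mul 2 8]
      norm_num
    rw [hprod, pow_succ, mul_comm]
    refine Nat.mul_le_mul_right _ (Nat.pow_le_pow_right (by norm_num) ?_)
    have h1 := (sum_levelExponent N (N - c) (by omega)).1
    rw [show N - (N - c) = c by omega] at h1
    change ((∑ i ∈ Finset.Ico c N, r i : ℕ) : ℝ) ≤ _ at h1
    set j := N - c with hj
    have hj1 : (1 : ℝ) ≤ j := by
      have : 1 ≤ j := by omega
      exact_mod_cast this
    have h2 : ((j * r c : ℕ) : ℝ) ≤ (N : ℝ) ^ 2 * (1 / (j + 1)) := by
      have : (r c : ℝ) ≤ (N : ℝ) ^ 2 / (j * (j + 1)) := by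
        exact_mod_cast Nat.cast_div_le (α := ℝ) (m := N ^ 2) (n := j * (j + 1))
      rw [Nat.cast_mul]
      calc (j : ℝ) * r c ≤ j * ((N : ℝ) ^ 2 / (j * (j + 1))) := by gcongr
        _ = (N : ℝ) ^ 2 * (1 / (j + 1)) := by field_simp
    have h3 : ((j * r c + ∑ i ∈ Finset.Ico c N, r i : ℕ) : ℝ) ≤ ((N ^ 2 : ℕ) : ℝ) := by
      rw [Nat.cast_add, Nat.cast_pow]
      linarith
    have h4 := Nat.cast_le.1 h3
    omega
  set T := 2 ^ (2 * ∑ i ∈ Finset.range N, r i) with hTdef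
  have hT1 : 1 ≤ T := Nat.one_le_two_pow
  obtain ⟨h, t, c, e, hc, hb, hsel, hloc, hsep⟩ := exists_path_of_points
    (S := (Finset.range N).biUnion L) hT1 (fun k hk => by
      obtain ⟨hx, c, hc, p, hp, q, hq, hrest⟩ := hzz k hk
      exact ⟨hx, p, Finset.mem_biUnion.2 ⟨c, Finset.mem_range.2 hc, hp⟩, q,
        Finset.mem_biUnion.2 ⟨c, Finset.mem_range.2 hc, hq⟩, hrest⟩)
  set S := insert (0, y 0) (insert (0, y (T - 1)) ((Finset.range N).biUnion L)) with hSdef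
  refine ⟨S.card, T, h, fun i => (S.equivFin.symm i).1.1, fun i => (S.equivFin.symm i).1.2, t, c, e,
    ?_, ?_, hc, hb, fun u => ?_, hloc, hsep⟩
  · have h1 : ((Finset.range N).biUnion L).card ≤ N * 2 ^ (N ^ 2 + 8 * N + 1) := by
      have := Finset.card_biUnion_le_card_mul (Finset.range N) L _ fun c hc =>
        hcard c (Finset.mem_range.1 hc)
      rwa [Finset.card_range] at this
    have h2 : S.card ≤ ((Finset.range N).biUnion L).card + 1 + 1 :=
      (Finset.card_insert_le _ _).trans (Nat.add_le_add_right (Finset.card_insert_le _ _) 1)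
    have h3 : 2 ≤ 2 ^ (N ^ 2 + 8 * N + 1) := by
      rw [pow_succ]
      have : 1 ≤ 2 ^ (N ^ 2 + 8 * N) := Nat.one_le_two_pow
      omega
    have h4 : N + 1 ≤ 2 ^ N := Nat.lt_two_pow_self
    calc S.card ≤ (N + 1) * 2 ^ (N ^ 2 + 8 * N + 1) := by
          rw [add_mul, one_mul]
          omega
      _ ≤ 2 ^ N * 2 ^ (N ^ 2 + 8 * N + 1) := Nat.mul_le_mul_right _ h4
      _ = 2 ^ (N ^ 2 + 9 * N + 1) := by
          rw [← pow_add]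
          congr 1
          ring
  · rw [hTdef, ← pow_add]
    refine Nat.pow_le_pow_right (by norm_num) ?_
    have h1 := (sum_levelExponent N N le_rfl).2
    rw [Nat.sub_self, ← Finset.range_eq_Ico] at h1
    change _ ≤ ((∑ i ∈ Finset.range N, r i : ℕ) : ℝ) at h1
    have h2 : (N : ℝ) ^ 2 * (1 / (N + 1)) ≤ N := by
      rw [mul_one_div, div_le_iff₀ (by positivity)]
      nlinarith [(N.cast_nonneg : (0 : ℝ) ≤ N)]
    have h3 : ((N ^ 2 : ℕ) : ℝ) ≤ ((∑ i ∈ Finset.range N, r i + 2 * N : ℕ) : ℝ) := by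
      rw [Nat.cast_add, Nat.cast_pow, Nat.cast_mul, Nat.cast_ofNat]
      linarith
    have h4 := Nat.cast_le.1 h3
    omega
  · obtain ⟨p, hp, hup⟩ := hsel u
    exact ⟨S.equivFin ⟨p, hp⟩, by simpa using hup⟩

/-- For every `d ≥ 1` there are constants `α, β, c > 0` such that for
every `m ≥ 2` there is a CPA function `f : ℝ^d → ℝ` with at most `α·m` affine components
and at least `β · m^(d + 1 - c/√(log₂ m))` pairwise distinct maximal pieces. -/
theorem cpa_lower_bound_dDim (d : ℕ) (hd : 1 ≤ d) :
    ∃ α β c : ℝ, 0 < α ∧ 0 < β ∧ 0 < c ∧ ∀ m : ℕ, 2 ≤ m →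
      ∃ f : (Fin d → ℝ) → ℝ, IsCPA f ∧
        (∃ k : ℕ, (k : ℝ) ≤ α * m ∧
          ∃ g : Fin k → (Fin d → ℝ) → ℝ, (∀ i, IsAffineFn (g i)) ∧ ∀ x, ∃ i, f x = g i x) ∧
        ∃ Ps : Finset (Set (Fin d → ℝ)), (∀ P ∈ Ps, IsMaximalPiece f P) ∧
          β * (m : ℝ) ^ ((d : ℝ) + 1 - c / Real.sqrt (Real.logb 2 m)) ≤ Ps.card := by
  refine ⟨1 + 2 * d, 1, 48, by positivity, one_pos, by norm_num, fun m hm => ?_⟩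
  have hm2 : (2 : ℝ) ≤ m := by exact_mod_cast hm
  have hm0 : (0 : ℝ) < m := by linarith
  set ℓ := √(Real.logb 2 m) with hℓ
  have hlog : 1 ≤ Real.logb 2 m := by
    rw [Real.le_logb_iff_rpow_le (by norm_num) hm0, Real.rpow_one]
    exact hm2
  have hℓ1 : 1 ≤ ℓ := Real.one_le_sqrt.2 hlog
  have hℓsq : ℓ ^ 2 = Real.logb 2 m := Real.sq_sqrt (by linarith)
  have hmℓ : (2 : ℝ) ^ (ℓ ^ 2) = m := by
    rw [hℓsq]
    exact Real.rpow_logb (by norm_num) (by norm_num) hm0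
  set N := ⌊ℓ⌋₊ - 10 with hN
  have hfloor : (⌊ℓ⌋₊ : ℝ) ≤ ℓ := Nat.floor_le (by linarith)
  have hNℓ : (N : ℝ) ≤ ℓ := by
    refine le_trans ?_ hfloor
    exact_mod_cast Nat.sub_le _ _
  have hℓN : ℓ < N + 11 := by
    refine (Nat.lt_floor_add_one ℓ).trans_le ?_
    have : ⌊ℓ⌋₊ + 1 ≤ N + 11 := by omega
    exact_mod_cast this
  obtain ⟨n, T, h, a, b, t, c, e, hn, hT, hcont, hbdd, hsel, hloc, hsep⟩ := exists_path N
  have hnm : n ≤ m := by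
    rcases Nat.eq_zero_or_pos N with h0 | hpos
    · rw [h0] at hn
      norm_num at hn
      omega
    · have h1 : (N : ℝ) + 10 ≤ ℓ := by
        have : N + 10 ≤ ⌊ℓ⌋₊ := by omega
        exact le_trans (by exact_mod_cast this) hfloor
      have h2 : ((2 ^ (N ^ 2 + 9 * N + 1) : ℕ) : ℝ) ≤ m := by
        rw [← hmℓ, Nat.cast_pow, Nat.cast_ofNat, ← Real.rpow_natCast]
        refine Real.rpow_le_rpow_of_exponent_le (by norm_num) ?_
        push_cast
        nlinarith [(N.cast_nonneg : (0 : ℝ) ≤ N)]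
      exact hn.trans (Nat.cast_le.1 h2)
  obtain ⟨f, hf, ⟨g, hg⟩, Ps, hPs, hcard⟩ :=
    exists_cpa_of_path hd hcont hbdd hsel hloc hsep (m := m) (by omega)
  refine ⟨f, hf, ⟨_, ?_, g, hg⟩, Ps, hPs, ?_⟩
  · have : (n : ℝ) ≤ m := by exact_mod_cast hnm
    push_cast
    linarith
  · have hTm : (m : ℝ) ^ (2 - 48 / ℓ) ≤ T := by
      have h1 : ((2 : ℝ) ^ ((2 * N ^ 2 : ℕ) : ℝ)) ≤ T * (2 : ℝ) ^ ((4 * N : ℕ) : ℝ) := by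
        rw [Real.rpow_natCast, Real.rpow_natCast]
        exact_mod_cast hT
      refine le_of_mul_le_mul_right (le_trans ?_ h1)
        (by positivity : 0 < (2 : ℝ) ^ ((4 * N : ℕ) : ℝ))
      rw [← hmℓ, ← Real.rpow_mul (by norm_num), ← Real.rpow_add (by norm_num)]
      refine Real.rpow_le_rpow_of_exponent_le (by norm_num) ?_
      have h2 : ℓ ^ 2 * (2 - 48 / ℓ) = 2 * ℓ ^ 2 - 48 * ℓ := by
        field_simp
      rw [h2]
      push_cast
      nlinarith [(N.cast_nonneg : (0 : ℝ) ≤ N)]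
    rw [one_mul, hcard, show (d : ℝ) + 1 - 48 / ℓ = (2 - 48 / ℓ) + ((d - 1 : ℕ) : ℝ) by
      rw [Nat.cast_sub hd]
      push_cast
      ring, Real.rpow_add hm0, Real.rpow_natCast]
    push_cast
    gcongr
end
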